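/- arXiv:2009.10754 — 5 statements merged into one kernel-verified Lean document; each statement's English description precedes it below -/
import Mathlib

section
/- For every n ≥ 1, the function H : {-1,1}^n → ℝ defined by H(x) = Im(∏_{j=1}^n (1 + (i/√n)·x_j)) has Fourier coefficients Ĥ(S) = Im((i/√n)^{|S|}) for every S ⊆ [n]. In particular Ĥ({j}) = 1/√n for every j ∈ [n], and |Ĥ(S)| ≤ n^{−|S|/2} for every S ⊆ [n]. -/
open Finset Real

noncomputable section

/-- The discrete cube `{-1,1}^n` as a finite set of points of `ℝ^n`. -/
def cube (n : ℕ) : Finset (Fin n → ℝ) :=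
  Fintype.piFinset fun _ => ({-1, 1} : Finset ℝ)

/-- Expectation of `g(X)` for `X` uniform on the discrete cube `{-1,1}^n`. -/
def cubeAvg (n : ℕ) (g : (Fin n → ℝ) → ℝ) : ℝ :=
  (∑ x ∈ cube n, g x) / (2 : ℝ) ^ n

/-- Fourier coefficient `f̂(S) = E[f(X)·χ_S(X)]` of a (vector-valued) function on the cube. -/
def cubeFourier {E : Type*} [AddCommGroup E] [Module ℝ E]
    (n : ℕ) (f : (Fin n → ℝ) → E) (S : Finset (Fin n)) : E :=
  (((2 : ℝ) ^ n)⁻¹) • ∑ x ∈ cube n, (∏ j ∈ S, x j) • f x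

/-- The Rademacher projection (linear part) `Rad f(x) = Σ_j f̂({j})·x_j`. -/
def rad {E : Type*} [AddCommGroup E] [Module ℝ E]
    (n : ℕ) (f : (Fin n → ℝ) → E) (x : Fin n → ℝ) : E :=
  ∑ j : Fin n, x j • cubeFourier n f {j}

/-- The function `H(x) = Im(∏_j (1 + (i/√n)·x_j))`. -/
def Hfun (n : ℕ) (x : Fin n → ℝ) : ℝ :=
  (∏ j : Fin n, (1 + (Complex.I / (Real.sqrt n : ℂ)) * (x j : ℂ))).im

/-- The unnormalised Fourier coefficients of `∏ j, (1 + a * x j)` on the cube. -/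
theorem sum_cube_prod_mul_prod_one_add (n : ℕ) (a : ℂ) (S : Finset (Fin n)) :
    ∑ x ∈ cube n, (∏ j ∈ S, (x j : ℂ)) * ∏ j : Fin n, (1 + a * (x j : ℂ)) =
      2 ^ n * a ^ S.card := by
  have factor : ∀ j : Fin n,
      ∑ t ∈ ({-1, 1} : Finset ℝ), (if j ∈ S then (t : ℂ) else 1) * (1 + a * (t : ℂ)) =
        2 * (if j ∈ S then a else 1) := by
    intro j
    rw [Finset.sum_pair (by norm_num)]
    split_ifs <;> push_cast <;> ring
  calc
    _ = ∑ x ∈ cube n, ∏ j : Fin n,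
          (if j ∈ S then (x j : ℂ) else 1) * (1 + a * (x j : ℂ)) := by
      refine Finset.sum_congr rfl fun x _ => ?_
      rw [Finset.prod_mul_distrib, Finset.prod_ite_mem, Finset.univ_inter]
    _ = ∏ j : Fin n, 2 * (if j ∈ S then a else 1) := by
      rw [cube, ← Finset.prod_univ_sum (fun _ => ({-1, 1} : Finset ℝ))
        (fun j t => (if j ∈ S then (t : ℂ) else 1) * (1 + a * (t : ℂ)))]
      exact Finset.prod_congr rfl fun j _ => factor j
    _ = 2 ^ n * a ^ S.card := by
      rw [Finset.prod_mul_distrib, Finset.prod_ite_mem, Finset.univ_inter]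
      simp

theorem cubeFourier_Hfun (n : ℕ) (S : Finset (Fin n)) :
    cubeFourier n (Hfun n) S = ((Complex.I / (Real.sqrt n : ℂ)) ^ S.card).im := by
  have key := congrArg Complex.im
    (sum_cube_prod_mul_prod_one_add n (Complex.I / (Real.sqrt n : ℂ)) S)
  have two_pow : (2 ^ n : ℂ) = ((2 ^ n : ℝ) : ℂ) := by push_cast; rfl
  simp only [← Complex.ofReal_prod, Complex.im_sum, two_pow, Complex.im_ofReal_mul] at key
  simp only [cubeFourier, Hfun, smul_eq_mul]
  rw [key, inv_mul_cancel_left₀ (by positivity)]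

theorem norm_I_div_sqrt_pow (n k : ℕ) :
    ‖(Complex.I / (Real.sqrt n : ℂ)) ^ k‖ = (n : ℝ) ^ (-(k : ℝ) / 2) := by
  rw [norm_pow, norm_div, Complex.norm_I, Complex.norm_real,
    Real.norm_of_nonneg (Real.sqrt_nonneg _), one_div, Real.sqrt_eq_rpow,
    ← Real.rpow_neg n.cast_nonneg, ← Real.rpow_mul_natCast n.cast_nonneg]
  congr 1
  ring

/-- Fourier coefficients of `H`: `Ĥ(S) = Im((i/√n)^{|S|})`; in particular
`Ĥ({j}) = 1/√n` and `|Ĥ(S)| ≤ n^{−|S|/2}`. -/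
theorem Hfun_fourier (n : ℕ) (hn : 1 ≤ n) :
    (∀ S : Finset (Fin n),
      cubeFourier n (Hfun n) S = ((Complex.I / (Real.sqrt n : ℂ)) ^ S.card).im) ∧
    (∀ j : Fin n, cubeFourier n (Hfun n) {j} = 1 / Real.sqrt n) ∧
    (∀ S : Finset (Fin n),
      |cubeFourier n (Hfun n) S| ≤ (n : ℝ) ^ (-(S.card : ℝ) / 2)) := by
  refine ⟨cubeFourier_Hfun n, fun j => ?_, fun S => ?_⟩
  · rw [cubeFourier_Hfun, Finset.card_singleton, pow_one, Complex.div_ofReal_im, Complex.I_im]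
  · rw [cubeFourier_Hfun, ← norm_I_div_sqrt_pow]
    exact Complex.abs_im_le_norm _
end
end

section
/- There are constants C, c > 0 such that the following holds for every n ≥ 1. Let H : {-1,1}^n → ℝ be defined by H(x) = Im(∏_{j=1}^n (1 + (i/√n)·x_j)), and let F : {-1,1}^n → ℝ be the truncation F(x) = Σ_{S ⊆ [n], |S| ≤ 3√n} Ĥ(S)·χ_S(x). Then |H(x) − F(x)| ≤ C·2^{−c√n} for every x ∈ {-1,1}^n. -/
open Finset Real

noncomputable section

open scoped Classical in
/-- The truncation of `H` to frequencies of size at most `3√n`: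
`F(x) = Σ_{|S| ≤ 3√n} Ĥ(S)·χ_S(x)`. -/
def Ffun (n : ℕ) (x : Fin n → ℝ) : ℝ :=
  ∑ S ∈ Finset.univ.filter
      (fun S : Finset (Fin n) => (S.card : ℝ) ≤ 3 * Real.sqrt n),
    cubeFourier n (Hfun n) S * ∏ j ∈ S, x j

/-- Orthogonality of the characters on the discrete cube. -/
theorem sum_cube_prod_mul_prod (n : ℕ) (S T : Finset (Fin n)) :
    ∑ x ∈ cube n, (∏ j ∈ S, x j) * ∏ j ∈ T, x j = if S = T then (2 : ℝ) ^ n else 0 := by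
  have key : ∑ x ∈ cube n, (∏ j ∈ S, x j) * ∏ j ∈ T, x j
      = ∏ j : Fin n, if (j ∈ S ↔ j ∈ T) then (2 : ℝ) else 0 := by
    have h := Finset.prod_univ_sum (fun _ : Fin n => ({-1, 1} : Finset ℝ))
      (fun j y => (if j ∈ S then y else 1) * (if j ∈ T then y else 1))
    have hne : (-1 : ℝ) ≠ 1 := by norm_num
    rw [cube]
    calc _ = _ := Finset.sum_congr rfl fun x _ => ?_
      _ = _ := h.symm
      _ = _ := Finset.prod_congr rfl fun j _ => ?_
    · rw [Finset.prod_mul_distrib, Finset.prod_ite_mem, Finset.prod_ite_mem, Finset.univ_inter,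
        Finset.univ_inter]
    · rw [Finset.sum_pair hne]
      by_cases hS : j ∈ S <;> by_cases hT : j ∈ T <;> simp [hS, hT] <;> norm_num
  rw [key]
  split_ifs with hST
  · subst hST
    simp
  · obtain ⟨j, hj⟩ : ∃ j, ¬ (j ∈ S ↔ j ∈ T) := by
      by_contra! hcon
      exact hST (Finset.ext hcon)
    exact Finset.prod_eq_zero (Finset.mem_univ j) (if_neg hj)

/-- The Fourier expansion of `Hfun`. -/
theorem Hfun_eq_sum (n : ℕ) (x : Fin n → ℝ) :
    Hfun n x = ∑ S : Finset (Fin n),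
      ((Complex.I / (Real.sqrt n : ℂ)) ^ S.card).im * ∏ j ∈ S, x j := by
  rw [Hfun, Finset.prod_one_add, Finset.powerset_univ, Complex.im_sum]
  refine Finset.sum_congr rfl fun S _ => ?_
  rw [Finset.prod_mul_distrib, Finset.prod_const, ← Complex.ofReal_prod, Complex.im_mul_ofReal]

theorem abs_prod_of_mem_cube {n : ℕ} {x : Fin n → ℝ} (hx : x ∈ cube n) (S : Finset (Fin n)) :
    |∏ j ∈ S, x j| = 1 := by
  rw [Finset.abs_prod]
  refine Finset.prod_eq_one fun j _ => ?_
  have h := Fintype.mem_piFinset.1 hx j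
  rcases (by simpa using h : x j = -1 ∨ x j = 1) with h | h <;> simp [h]

theorem abs_im_pow_le (n k : ℕ) :
    |((Complex.I / (Real.sqrt n : ℂ)) ^ k).im| ≤ (1 / Real.sqrt n) ^ k := by
  refine (Complex.abs_im_le_norm _).trans_eq ?_
  rw [norm_pow, norm_div, Complex.norm_I, Complex.norm_real, Real.norm_of_nonneg (Real.sqrt_nonneg _)]

/-- Exponential-moment bound for the high-degree part of `∏ (1 + 1 / √n)`. -/
theorem sum_high_degree_le {n : ℕ} (hn : 1 ≤ n) (s : Finset (Finset (Fin n)))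
    (hs : ∀ S ∈ s, 3 * Real.sqrt n ≤ (S.card : ℝ)) :
    ∑ S ∈ s, (1 / Real.sqrt n) ^ S.card
      ≤ (3 : ℝ) ^ (-(3 * Real.sqrt n)) * Real.exp (3 * Real.sqrt n) := by
  have ha : 0 < Real.sqrt n := Real.sqrt_pos.2 (by exact_mod_cast hn)
  calc ∑ S ∈ s, (1 / Real.sqrt n) ^ S.card
      ≤ ∑ S ∈ s, (3 : ℝ) ^ (-(3 * Real.sqrt n)) * (3 / Real.sqrt n) ^ S.card := by
        refine Finset.sum_le_sum fun S hS => ?_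
        have h1 : (1 : ℝ) ≤ (3 : ℝ) ^ (-(3 * Real.sqrt n)) * 3 ^ S.card := by
          rw [← Real.rpow_natCast, ← Real.rpow_add (by norm_num)]
          exact Real.one_le_rpow (by norm_num) (by linarith [hs S hS])
        calc (1 / Real.sqrt n) ^ S.card = 1 * (1 / Real.sqrt n) ^ S.card := (one_mul _).symm
          _ ≤ (3 : ℝ) ^ (-(3 * Real.sqrt n)) * 3 ^ S.card * (1 / Real.sqrt n) ^ S.card := by
            gcongr
          _ = _ := by rw [mul_assoc, ← mul_pow, mul_one_div]
    _ ≤ ∑ S : Finset (Fin n), (3 : ℝ) ^ (-(3 * Real.sqrt n)) * (3 / Real.sqrt n) ^ S.card :=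
        Finset.sum_le_sum_of_subset_of_nonneg (Finset.subset_univ s) fun _ _ _ => by positivity
    _ = (3 : ℝ) ^ (-(3 * Real.sqrt n)) * (1 + 3 / Real.sqrt n) ^ n := by
        have h := Finset.prod_one_add (f := fun _ : Fin n => 3 / Real.sqrt n) Finset.univ
        simp only [Finset.prod_const, Finset.card_univ, Fintype.card_fin,
          Finset.powerset_univ] at h
        rw [h, Finset.mul_sum]
    _ ≤ _ := by
        have h2 : Real.exp (3 * Real.sqrt n) = Real.exp (3 / Real.sqrt n) ^ n := by
          rw [← Real.exp_nat_mul]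
          congr 1
          field_simp
          rw [Real.sq_sqrt (Nat.cast_nonneg n)]
        rw [h2]
        gcongr
        linarith [Real.add_one_le_exp (3 / Real.sqrt n)]

theorem log_three_gt_one : 1 < Real.log 3 := by
  rw [Real.lt_log_iff_exp_lt (by norm_num)]
  linarith [Real.exp_one_lt_d9]

/-- The truncation `F` is uniformly exponentially close to `H` on the cube. -/
theorem Hfun_truncation_close :
    ∃ C : ℝ, 0 < C ∧ ∃ c : ℝ, 0 < c ∧
      ∀ n : ℕ, 1 ≤ n → ∀ x ∈ cube n,
        |Hfun n x - Ffun n x| ≤ C * (2 : ℝ) ^ (-c * Real.sqrt n) := by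
  have hl2 : 0 < Real.log 2 := Real.log_pos (by norm_num)
  refine ⟨1, one_pos, 3 * (Real.log 3 - 1) / Real.log 2,
    div_pos (by linarith [log_three_gt_one]) hl2, fun n hn x hx => ?_⟩
  classical
  have hdiff : Hfun n x - Ffun n x = ∑ S : Finset (Fin n) with ¬ (S.card : ℝ) ≤ 3 * Real.sqrt n,
      ((Complex.I / (Real.sqrt n : ℂ)) ^ S.card).im * ∏ j ∈ S, x j := by
    rw [Hfun_eq_sum, Ffun, sub_eq_iff_eq_add']
    simp_rw [cubeFourier_Hfun]
    rw [← Finset.sum_filter_add_sum_filter_not Finset.univ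
      (fun S : Finset (Fin n) => (S.card : ℝ) ≤ 3 * Real.sqrt n)]
  calc |Hfun n x - Ffun n x|
      ≤ ∑ S : Finset (Fin n) with ¬ (S.card : ℝ) ≤ 3 * Real.sqrt n,
          (1 / Real.sqrt n) ^ S.card := by
        rw [hdiff]
        refine (Finset.abs_sum_le_sum_abs _ _).trans (Finset.sum_le_sum fun S _ => ?_)
        rw [abs_mul, abs_prod_of_mem_cube hx, mul_one]
        exact abs_im_pow_le n S.card
    _ ≤ (3 : ℝ) ^ (-(3 * Real.sqrt n)) * Real.exp (3 * Real.sqrt n) :=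
        sum_high_degree_le hn _ fun S hS => (not_le.1 (Finset.mem_filter.1 hS).2).le
    _ = 1 * (2 : ℝ) ^ (-(3 * (Real.log 3 - 1) / Real.log 2) * Real.sqrt n) := by
        rw [Real.rpow_def_of_pos (by norm_num), Real.rpow_def_of_pos (by norm_num),
          ← Real.exp_add, one_mul]
        congr 1
        field_simp
        ring
end
end

section
/- There is a constant c > 0 such that for every n ≥ 1 and every function f : {-1,1}^n → [−1, 1], log(‖f̂‖₀ + 1) ≥ c·Σ_{j=1}^n |f̂({j})|, where ‖f̂‖₀ is the number of sets S ⊆ [n] with f̂(S) ≠ 0. -/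
open Finset Real

noncomputable section

open scoped Classical in
/-- The Fourier sparsity `‖f̂‖₀`: the number of sets `S ⊆ [n]` with `f̂(S) ≠ 0`. -/
def sparsity (n : ℕ) (f : (Fin n → ℝ) → ℝ) : ℕ :=
  (Finset.univ.filter fun S : Finset (Fin n) => cubeFourier n f S ≠ 0).card

section PolynomialBound

open Polynomial

/-- Decomposition of a polynomial into its even and odd parts. -/
lemma expand_contract_add_X_mul_expand_contract_divX (q : ℝ[X]) :
    expand ℝ 2 (contract 2 q) + X * expand ℝ 2 (contract 2 q.divX) = q := by
  ext k
  rcases k with _ | k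
  · simp [coeff_expand, coeff_contract]
  · rw [coeff_add, coeff_X_mul, coeff_expand two_pos, coeff_expand two_pos]
    rcases Nat.even_or_odd' k with ⟨m, rfl | rfl⟩
    · simp [coeff_contract, coeff_divX, mul_comm]
    · have h : ¬ 2 ∣ 2 * m + 1 := by omega
      have h' : 2 ∣ 2 * m + 1 + 1 := by omega
      have h'' : (2 * m + 1 + 1) / 2 * 2 = 2 * m + 1 + 1 := by omega
      simp [h, h', h'', coeff_contract]

/-- The endpoint Markov inequality, transported to the interval `[0, 1]`. -/
lemma neg_coeff_one_le_of_abs_le_one_on_unitInterval {d : ℕ} {h : ℝ[X]} (hd : h.natDegree ≤ d)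
    (hb : ∀ t ∈ Set.Icc (0 : ℝ) 1, |h.eval t| ≤ 1) :
    -h.coeff 1 ≤ 2 * (d : ℝ) ^ 2 := by
  have key := Chebyshev.eval_iterate_derivative_le_of_forall_abs_le_one (n := d) (k := 1)
    (P := h.comp (C (1 / 2) * (1 - X))) (x := 1) le_rfl ?_ ?_
  · simp only [Function.iterate_one, derivative_comp] at key
    have h1 : (derivative h).eval 0 = h.coeff 1 := by
      rw [← coeff_zero_eq_eval_zero, coeff_derivative]; simp
    have h2 : (derivative (Chebyshev.T ℝ d)).eval 1 = (d : ℝ) ^ 2 := by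
      simp [Chebyshev.derivative_T_eval_one]
    rw [h2] at key
    simp [h1] at key
    linarith
  · refine natDegree_le_iff_degree_le.mp (natDegree_comp_le.trans ?_)
    have : (C (1 / 2 : ℝ) * (1 - X)).natDegree ≤ 1 := by compute_degree
    nlinarith
  · intro x hx
    rw [eval_comp]
    apply hb
    simp only [eval_mul, eval_C, eval_sub, eval_one, eval_X]
    constructor <;> linarith [hx.1, hx.2]

/-- A weak form of Bernstein's inequality at the centre of the interval `[-1, 1]`. -/
lemma coeff_one_sq_le_of_forall_abs_le_one {d : ℕ} (h_pos : 1 ≤ d) {q : ℝ[X]}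
    (hd : q.natDegree ≤ d) (hb : ∀ x ∈ Set.Icc (-1 : ℝ) 1, |q.eval x| ≤ 1) :
    q.coeff 1 ^ 2 ≤ 2 * (d : ℝ) ^ 2 := by
  set r := contract 2 q.divX with hr
  have hrdeg : r.natDegree ≤ (d - 1) / 2 := by
    rw [natDegree_le_iff_coeff_eq_zero]
    intro N hN
    rw [hr, coeff_contract two_ne_zero, coeff_divX]
    apply coeff_eq_zero_of_natDegree_lt
    omega
  have hr0 : r.coeff 0 = q.coeff 1 := by
    rw [hr, coeff_contract two_ne_zero, coeff_divX]
  have hodd : ∀ x : ℝ, x * r.eval (x ^ 2) = (q.eval x - q.eval (-x)) / 2 := by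
    intro x
    rw [← expand_contract_add_X_mul_expand_contract_divX q]
    simp only [eval_add, eval_mul, eval_X, expand_eval, even_two.neg_pow]
    ring
  have key := neg_coeff_one_le_of_abs_le_one_on_unitInterval (d := d) (h := -(X * r ^ 2)) ?_ ?_
  · rw [coeff_neg, neg_neg, coeff_X_mul, coeff_zero_eq_eval_zero, eval_pow,
      ← coeff_zero_eq_eval_zero, hr0] at key
    exact key
  · rw [natDegree_neg]
    have h1 : (X * r ^ 2).natDegree ≤ 1 + 2 * r.natDegree :=
      natDegree_mul_le.trans (add_le_add natDegree_X_le natDegree_pow_le)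
    omega
  · intro t ht
    have hs : Real.sqrt t ^ 2 = t := Real.sq_sqrt ht.1
    have hs1 : Real.sqrt t ≤ 1 := Real.sqrt_le_one.mpr ht.2
    have hs0 := Real.sqrt_nonneg t
    have ho := hodd (Real.sqrt t)
    have h1 := abs_le.mp (hb (Real.sqrt t) ⟨by linarith, hs1⟩)
    have h2 := abs_le.mp (hb (-Real.sqrt t) ⟨by linarith, by linarith⟩)
    have h3 : |Real.sqrt t * r.eval (Real.sqrt t ^ 2)| ≤ 1 := by
      rw [ho, abs_le]; constructor <;> linarith
    have h4 : |(-(X * r ^ 2)).eval t| = |Real.sqrt t * r.eval (Real.sqrt t ^ 2)| ^ 2 := by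
      rw [hs, ← abs_pow, mul_pow, hs]
      simp
    rw [h4]
    exact pow_le_one₀ (abs_nonneg _) h3

end PolynomialBound

/-- The multilinear extension of a function bounded by one on the cube is bounded by one on the
solid cube. -/
lemma abs_sum_cubeFourier_mul_prod_le_one {n : ℕ} {f : (Fin n → ℝ) → ℝ}
    (hf : ∀ x ∈ cube n, f x ∈ Set.Icc (-1 : ℝ) 1) {a : Fin n → ℝ} (ha : ∀ j, |a j| ≤ 1) :
    |∑ S : Finset (Fin n), cubeFourier n f S * ∏ j ∈ S, a j| ≤ 1 := by
  have hexp : ∑ S : Finset (Fin n), cubeFourier n f S * ∏ j ∈ S, a j =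
      ((2 : ℝ) ^ n)⁻¹ * ∑ x ∈ cube n, f x * ∏ j, (1 + x j * a j) := by
    simp only [cubeFourier, smul_eq_mul, Finset.prod_one_add, Finset.powerset_univ,
      Finset.mul_sum, Finset.sum_mul, Finset.prod_mul_distrib]
    rw [Finset.sum_comm]
    refine Finset.sum_congr rfl fun x _ => Finset.sum_congr rfl fun S _ => ?_
    ring
  have hsum : ∑ x ∈ cube n, ∏ j, (1 + x j * a j) = (2 : ℝ) ^ n := by
    rw [cube, ← Finset.prod_univ_sum (fun _ => ({-1, 1} : Finset ℝ)) fun j t => 1 + t * a j]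
    have : ∀ j, ∑ t ∈ ({-1, 1} : Finset ℝ), (1 + t * a j) = 2 := by
      intro j
      rw [Finset.sum_pair (by norm_num)]
      ring
    simp [this]
  rw [hexp, abs_mul, abs_of_pos (by positivity : (0 : ℝ) < ((2 : ℝ) ^ n)⁻¹),
    inv_mul_le_iff₀ (by positivity), mul_one, ← hsum]
  refine (Finset.abs_sum_le_sum_abs _ _).trans (Finset.sum_le_sum fun x hx => ?_)
  have hnn : 0 ≤ ∏ j, (1 + x j * a j) := by
    refine Finset.prod_nonneg fun j _ => ?_
    have hxj : x j = -1 ∨ x j = 1 := by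
      simpa using Fintype.mem_piFinset.mp hx j
    have := abs_le.mp (ha j)
    rcases hxj with h | h <;> rw [h] <;> linarith
  rw [abs_mul, abs_of_nonneg hnn]
  exact mul_le_of_le_one_left hnn (abs_le.mpr (hf x hx))

lemma abs_prod_le_pow_card {ι : Type*} {a : ι → ℝ} {ρ : ℝ} (ha : ∀ j, |a j| ≤ ρ) (S : Finset ι) :
    |∏ j ∈ S, a j| ≤ ρ ^ S.card := by
  rw [Finset.abs_prod]
  exact (Finset.prod_le_prod (fun j _ => abs_nonneg _) fun j _ => ha j).trans_eq
    (Finset.prod_const ρ)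

lemma abs_cubeFourier_le_one {n : ℕ} {f : (Fin n → ℝ) → ℝ}
    (hf : ∀ x ∈ cube n, f x ∈ Set.Icc (-1 : ℝ) 1) (S : Finset (Fin n)) :
    |cubeFourier n f S| ≤ 1 := by
  have hcard : (cube n).card = 2 ^ n := by
    rw [cube, Fintype.card_piFinset]
    simp [Finset.card_pair (show (-1 : ℝ) ≠ 1 by norm_num)]
  rw [cubeFourier, smul_eq_mul, abs_mul, abs_of_pos (by positivity : (0 : ℝ) < ((2 : ℝ) ^ n)⁻¹),
    inv_mul_le_iff₀ (by positivity), mul_one]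
  refine (Finset.abs_sum_le_sum_abs _ _).trans ?_
  refine (Finset.sum_le_card_nsmul _ _ 1 fun x hx => ?_).trans (by simp [hcard])
  have hx1 : |∏ j ∈ S, x j| = 1 := by
    rw [Finset.abs_prod]
    refine Finset.prod_eq_one fun j _ => ?_
    have hxj : x j = -1 ∨ x j = 1 := by
      simpa using Fintype.mem_piFinset.mp hx j
    rcases hxj with h | h <;> simp [h]
  rw [smul_eq_mul, abs_mul, hx1, one_mul]
  exact abs_le.mpr (hf x hx)

/-- Fourier tails at a point of the solid cube of radius `1 / 2` are controlled by the sparsity. -/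
lemma abs_sum_card_gt_le {n d : ℕ} {f : (Fin n → ℝ) → ℝ}
    (hf : ∀ x ∈ cube n, f x ∈ Set.Icc (-1 : ℝ) 1) (hd : sparsity n f ≤ 2 ^ (d + 1))
    {a : Fin n → ℝ} (ha : ∀ j, |a j| ≤ 1 / 2) :
    |∑ S : Finset (Fin n) with ¬ S.card ≤ d, cubeFourier n f S * ∏ j ∈ S, a j| ≤ 1 := by
  classical
  calc _ ≤ ∑ S : Finset (Fin n) with ¬ S.card ≤ d, |cubeFourier n f S * ∏ j ∈ S, a j| :=
        Finset.abs_sum_le_sum_abs _ _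
    _ ≤ ∑ S : Finset (Fin n) with ¬ S.card ≤ d,
          if cubeFourier n f S ≠ 0 then (1 / 2 : ℝ) ^ (d + 1) else 0 := by
        refine Finset.sum_le_sum fun S hS => ?_
        split_ifs with h
        · rw [abs_mul]
          have h1 := abs_prod_le_pow_card ha S
          have h2 : (1 / 2 : ℝ) ^ S.card ≤ (1 / 2) ^ (d + 1) :=
            pow_le_pow_of_le_one (by norm_num) (by norm_num)
              (not_le.mp (Finset.mem_filter.mp hS).2)
          exact (mul_le_of_le_one_left (abs_nonneg _) (abs_cubeFourier_le_one hf S)).trans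
            (h1.trans h2)
        · simp [not_not.mp h]
    _ ≤ ∑ S : Finset (Fin n), if cubeFourier n f S ≠ 0 then (1 / 2 : ℝ) ^ (d + 1) else 0 :=
        Finset.sum_le_sum_of_subset_of_nonneg (Finset.filter_subset _ _) fun S _ _ => by
          split_ifs <;> positivity
    _ = sparsity n f * (1 / 2 : ℝ) ^ (d + 1) := by
        rw [← Finset.sum_filter, Finset.sum_const, nsmul_eq_mul, sparsity]
    _ ≤ 2 ^ (d + 1) * (1 / 2 : ℝ) ^ (d + 1) := by
        gcongr
        exact_mod_cast hd
    _ = 1 := by rw [← mul_pow]; norm_num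

open Polynomial in
/-- The linear mass is at most linear in the binary logarithm of the sparsity. -/
lemma linear_mass_le {n d : ℕ} {f : (Fin n → ℝ) → ℝ} (h_pos : 1 ≤ d)
    (hf : ∀ x ∈ cube n, f x ∈ Set.Icc (-1 : ℝ) 1) (hd : sparsity n f ≤ 2 ^ (d + 1)) :
    ∑ j : Fin n, |cubeFourier n f {j}| ≤ 6 * d := by
  have hsign : ∀ j : Fin n, ∃ e : ℝ, |e| ≤ 1 ∧ cubeFourier n f {j} * e = |cubeFourier n f {j}| := by
    intro j
    rcases abs_cases (cubeFourier n f {j}) with ⟨h, -⟩ | ⟨h, -⟩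
    · exact ⟨1, by simp, by rw [h, mul_one]⟩
    · exact ⟨-1, by simp, by rw [h, mul_neg_one]⟩
  choose e he he' using hsign
  set q : ℝ[X] := ∑ S : Finset (Fin n) with S.card ≤ d,
    C (cubeFourier n f S * ∏ j ∈ S, e j) * (C (1 / 2) * X) ^ S.card with hq
  have hqdeg : (C (1 / 2) * q).natDegree ≤ d := by
    refine natDegree_C_mul_le _ _ |>.trans (natDegree_sum_le_of_forall_le _ _ fun S hS => ?_)
    rw [mul_pow, ← C_pow, ← mul_assoc, ← C_mul]
    exact (natDegree_C_mul_X_pow_le _ _).trans (Finset.mem_filter.mp hS).2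
  have hqeval : ∀ x, q.eval x =
      ∑ S : Finset (Fin n) with S.card ≤ d, cubeFourier n f S * ∏ j ∈ S, (e j * (x / 2)) := by
    intro x
    rw [hq, eval_finsetSum]
    refine Finset.sum_congr rfl fun S _ => ?_
    rw [Finset.prod_mul_distrib, Finset.prod_const]
    simp only [eval_mul, eval_C, eval_pow, eval_X]
    ring
  have hqcoeff : q.coeff 1 = (∑ j : Fin n, |cubeFourier n f {j}|) / 2 := by
    have hcoeff : ∀ S : Finset (Fin n),
        (C (cubeFourier n f S * ∏ j ∈ S, e j) * (C (1 / 2) * X) ^ S.card : ℝ[X]).coeff 1 =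
          if S.card = 1 then (cubeFourier n f S * ∏ j ∈ S, e j) / 2 else 0 := by
      intro S
      rw [mul_pow, ← C_pow, ← mul_assoc, ← C_mul, coeff_C_mul_X_pow]
      by_cases h : S.card = 1
      · simp [h, div_eq_mul_inv]
      · simp [h, Ne.symm h]
    rw [hq, finsetSum_coeff, Finset.sum_congr rfl fun S _ => hcoeff S, ← Finset.sum_filter,
      Finset.filter_filter]
    have hset : (Finset.univ.filter fun S : Finset (Fin n) => S.card ≤ d ∧ S.card = 1) =
        Finset.powersetCard 1 Finset.univ := by
      ext S
      simp only [Finset.mem_filter, Finset.mem_univ, true_and, Finset.mem_powersetCard,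
        Finset.subset_univ]
      omega
    rw [hset, Finset.powersetCard_one, Finset.sum_map, Finset.sum_div]
    refine Finset.sum_congr rfl fun j _ => ?_
    simp [he' j]
  have hqbound : ∀ x ∈ Set.Icc (-1 : ℝ) 1, |(C (1 / 2) * q).eval x| ≤ 1 := by
    intro x hx
    have ha : ∀ j, |e j * (x / 2)| ≤ 1 / 2 := by
      intro j
      have h1 : |x / 2| ≤ 1 / 2 := abs_le.mpr ⟨by linarith [hx.1], by linarith [hx.2]⟩
      rw [abs_mul]
      exact (mul_le_of_le_one_left (abs_nonneg _) (he j)).trans h1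
    have h1 := abs_le.mp <|
      abs_sum_cubeFourier_mul_prod_le_one hf fun j => (ha j).trans (by norm_num)
    have h2 := abs_le.mp <| abs_sum_card_gt_le hf hd ha
    have h3 := Finset.sum_filter_add_sum_filter_not Finset.univ
      (fun S : Finset (Fin n) => S.card ≤ d)
      (fun S => cubeFourier n f S * ∏ j ∈ S, (e j * (x / 2)))
    rw [eval_mul, eval_C, hqeval, abs_le]
    constructor <;> linarith [h1.1, h1.2, h2.1, h2.2]
  have key := coeff_one_sq_le_of_forall_abs_le_one h_pos hqdeg hqbound
  rw [coeff_C_mul, hqcoeff] at key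
  refine le_of_abs_le (abs_le_of_sq_le_sq ?_ (by positivity))
  nlinarith [sq_nonneg (d : ℝ)]

/-- A restriction on the Fourier spectrum of bounded functions on the cube:
the log of the sparsity dominates the `ℓ₁` mass of the linear coefficients. -/
theorem log_sparsity_ge_linear_mass :
    ∃ c : ℝ, 0 < c ∧
      ∀ n : ℕ, 1 ≤ n →
        ∀ f : (Fin n → ℝ) → ℝ,
          (∀ x ∈ cube n, f x ∈ Set.Icc (-1 : ℝ) 1) →
          Real.log ((sparsity n f : ℝ) + 1) ≥
            c * ∑ j : Fin n, |cubeFourier n f {j}| := by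
  refine ⟨Real.log 2 / 6, by positivity, fun n _ f hf => ?_⟩
  rcases Nat.eq_zero_or_pos (sparsity n f) with h0 | h_pos
  · have hzero : ∀ S, cubeFourier n f S = 0 := by
      simpa [sparsity, Finset.filter_eq_empty_iff] using h0
    simp [h0, hzero]
  · set d := Nat.log 2 (sparsity n f + 1)
    have hd1 : 1 ≤ d := Nat.log_pos one_lt_two (by omega)
    have hlt : sparsity n f + 1 < 2 ^ (d + 1) := Nat.lt_pow_succ_log_self one_lt_two _
    have hle : 2 ^ d ≤ sparsity n f + 1 := Nat.pow_log_le_self 2 (by omega)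
    have hmass := linear_mass_le hd1 hf (by omega : sparsity n f ≤ 2 ^ (d + 1))
    have hlog : d * Real.log 2 ≤ Real.log ((sparsity n f : ℝ) + 1) := by
      rw [← Real.log_pow]
      exact Real.log_le_log (by positivity) (by exact_mod_cast hle)
    have := mul_le_mul_of_nonneg_left hmass (show 0 ≤ Real.log 2 / 6 by positivity)
    linarith
end
end

section
/- There are constants C, c > 0 such that for every n ≥ 1 there exists a function f : {-1,1}^n → [−1, 1] with Σ_{j=1}^n |f̂({j})| ≥ c·√n and log(‖f̂‖₀) ≤ C·√n·log(n+1), where ‖f̂‖₀ is the number of sets S ⊆ [n] with f̂(S) ≠ 0. (Hence the inequality log(‖f̂‖₀+1) ≥ c'·Σ_j |f̂({j})| for bounded functions is sharp up to a factor of log n.) -/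
open Finset Real

noncomputable section

lemma sum_cube_succ (n : ℕ) (g : (Fin (n + 1) → ℝ) → ℝ) :
    ∑ x ∈ cube (n + 1), g x =
      ∑ x ∈ cube n, (g (Fin.cons 1 x) + g (Fin.cons (-1) x)) := by
  have h : ∑ x ∈ cube (n + 1), g x =
      ∑ p ∈ ({-1, 1} : Finset ℝ) ×ˢ cube n, g (Fin.cons p.1 p.2) := by
    refine Finset.sum_bij' (fun x _ => (x 0, Fin.tail x)) (fun p _ => Fin.cons p.1 p.2)
      ?_ ?_ ?_ ?_ ?_
    · intro x hx
      simp only [cube, Fintype.mem_piFinset] at hx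
      simp only [cube, Finset.mem_product, Fintype.mem_piFinset]
      exact ⟨hx 0, fun i => hx i.succ⟩
    · rintro ⟨a, y⟩ hp
      simp only [cube, Finset.mem_product, Fintype.mem_piFinset] at hp ⊢
      intro i
      refine Fin.cases ?_ (fun i => ?_) i
      · simpa using hp.1
      · simpa using hp.2 i
    · intro x _
      simp
    · rintro ⟨a, y⟩ _
      simp
    · intro x _
      simp
  rw [h, Finset.sum_product, Finset.sum_pair (by norm_num), Finset.sum_add_distrib, add_comm]

lemma sum_cube_one (n : ℕ) : ∑ _x ∈ cube n, (1 : ℝ) = 2 ^ n := by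
  induction n with
  | zero => simp [cube]
  | succ n ih =>
    rw [sum_cube_succ, Finset.sum_add_distrib, ih]
    ring

lemma sum_cube_sum_sq (n : ℕ) : ∑ x ∈ cube n, (∑ j, x j) ^ 2 = n * 2 ^ n := by
  induction n with
  | zero => simp
  | succ n ih =>
    have h (x : Fin n → ℝ) : (1 + ∑ j, x j) ^ 2 + (-1 + ∑ j, x j) ^ 2 =
        2 * (∑ j, x j) ^ 2 + 2 * 1 := by ring
    simp only [sum_cube_succ, Fin.sum_univ_succ, Fin.cons_zero, Fin.cons_succ, h,
      Finset.sum_add_distrib, ← Finset.mul_sum, ih, sum_cube_one]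
    push_cast
    ring

lemma sum_cube_sum_pow_four_le (n : ℕ) :
    ∑ x ∈ cube n, (∑ j, x j) ^ 4 ≤ 3 * n ^ 2 * 2 ^ n := by
  induction n with
  | zero => simp
  | succ n ih =>
    have h (x : Fin n → ℝ) : (1 + ∑ j, x j) ^ 4 + (-1 + ∑ j, x j) ^ 4 =
        2 * (∑ j, x j) ^ 4 + 12 * (∑ j, x j) ^ 2 + 2 * 1 := by ring
    simp only [sum_cube_succ, Fin.sum_univ_succ, Fin.cons_zero, Fin.cons_succ, h,
      Finset.sum_add_distrib, ← Finset.mul_sum, sum_cube_sum_sq, sum_cube_one]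
    have : (0 : ℝ) < 2 ^ n := by positivity
    push_cast
    rw [pow_succ (2 : ℝ) n]
    nlinarith

lemma sq_eq_one_of_mem_cube {n : ℕ} {x : Fin n → ℝ} (hx : x ∈ cube n) (j : Fin n) :
    x j ^ 2 = 1 := by
  simp only [cube, Fintype.mem_piFinset, Finset.mem_insert, Finset.mem_singleton] at hx
  rcases hx j with h | h <;> simp [h]

lemma sum_cube_prod_eq_zero {n : ℕ} {A : Finset (Fin n)} (hA : A.Nonempty) :
    ∑ x ∈ cube n, ∏ j ∈ A, x j = 0 := by
  obtain ⟨i, hi⟩ := hA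
  have h (x : Fin n → ℝ) : ∏ j ∈ A, x j = ∏ j, if j ∈ A then x j else 1 := by
    simp [Finset.prod_ite_mem]
  simp only [h, cube]
  rw [← Finset.prod_univ_sum (fun _ => ({-1, 1} : Finset ℝ))
    (fun j a => if j ∈ A then a else 1)]
  refine Finset.prod_eq_zero (Finset.mem_univ i) ?_
  rw [Finset.sum_pair (by norm_num)]
  simp [hi]

lemma sum_cube_prod_mul_sum_pow_eq_zero {n k : ℕ} {A : Finset (Fin n)} (hA : k < A.card) :
    ∑ x ∈ cube n, (∏ j ∈ A, x j) * (∑ j, x j) ^ k = 0 := by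
  induction k generalizing A with
  | zero => simpa using sum_cube_prod_eq_zero (Finset.card_pos.mp hA)
  | succ k ih =>
    simp only [pow_succ', Finset.sum_mul, Finset.mul_sum (s := univ)]
    rw [Finset.sum_comm]
    refine Finset.sum_eq_zero fun i _ => ?_
    by_cases hi : i ∈ A
    · rw [← ih (A := A.erase i) (by rw [Finset.card_erase_of_mem hi]; omega)]
      refine Finset.sum_congr rfl fun x hx => ?_
      rw [← Finset.mul_prod_erase A x hi]
      linear_combination (∏ j ∈ A.erase i, x j) * (∑ j, x j) ^ k * sq_eq_one_of_mem_cube hx i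
    · rw [← ih (A := insert i A) (by rw [Finset.card_insert_of_notMem hi]; omega)]
      refine Finset.sum_congr rfl fun x _ => ?_
      rw [Finset.prod_insert hi]
      ring

lemma cubeFourier_polynomial_sum_eq_zero {n : ℕ} (p : Polynomial ℝ) {A : Finset (Fin n)}
    (hA : p.natDegree < A.card) :
    cubeFourier n (fun x => p.eval ((∑ j, x j) / n)) A = 0 := by
  have h : ∑ x ∈ cube n, (∏ j ∈ A, x j) * p.eval ((∑ j, x j) / n) = 0 := by
    simp only [Polynomial.eval_eq_sum_range, Finset.mul_sum]
    rw [Finset.sum_comm]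
    refine Finset.sum_eq_zero fun i hi => ?_
    have hi' : i < A.card := by
      rw [Finset.mem_range] at hi
      omega
    have h0 := sum_cube_prod_mul_sum_pow_eq_zero hi'
    calc _ = ∑ x ∈ cube n, p.coeff i / n ^ i * ((∏ j ∈ A, x j) * (∑ j, x j) ^ i) :=
          Finset.sum_congr rfl fun x _ => by rw [div_pow]; ring
      _ = 0 := by rw [← Finset.mul_sum, h0, mul_zero]
  simp [cubeFourier, h]

lemma card_filter_card_le_le_pow (n d : ℕ) :
    (univ.filter fun S : Finset (Fin n) => S.card ≤ d).card ≤ (n + 1) ^ d := by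
  have hsub : (univ.filter fun S : Finset (Fin n) => S.card ≤ d) ⊆
      (Finset.range (d + 1)).biUnion fun k => Finset.powersetCard k univ := by
    intro S hS
    simp only [Finset.mem_filter, Finset.mem_univ, true_and] at hS
    simp only [Finset.mem_biUnion, Finset.mem_range, Finset.mem_powersetCard_univ]
    exact ⟨S.card, by omega, rfl⟩
  calc _ ≤ _ := Finset.card_le_card hsub
    _ ≤ ∑ k ∈ Finset.range (d + 1), (Finset.powersetCard k (univ : Finset (Fin n))).card :=
        Finset.card_biUnion_le
    _ ≤ ∑ k ∈ Finset.range (d + 1), n ^ k * 1 ^ (d - k) * d.choose k := by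
        refine Finset.sum_le_sum fun k hk => ?_
        rw [Finset.card_powersetCard, Finset.card_univ, Fintype.card_fin, one_pow, mul_one]
        have : 0 < d.choose k := Nat.choose_pos (by rw [Finset.mem_range] at hk; omega)
        exact (Nat.choose_le_pow n k).trans (Nat.le_mul_of_pos_right _ this)
    _ = (n + 1) ^ d := (add_pow n 1 d).symm

lemma log_sparsity_polynomial_sum_le {n d : ℕ} (p : Polynomial ℝ) (hp : p.natDegree ≤ d) :
    Real.log (sparsity n fun x => p.eval ((∑ j, x j) / n)) ≤ d * Real.log (n + 1) := by
  have hcard : sparsity n (fun x => p.eval ((∑ j, x j) / n)) ≤ (n + 1) ^ d := by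
    refine le_trans (Finset.card_le_card fun S hS => ?_) (card_filter_card_le_le_pow n d)
    simp only [Finset.mem_filter, Finset.mem_univ, true_and] at hS ⊢
    by_contra! h
    exact hS (cubeFourier_polynomial_sum_eq_zero p (by omega))
  rcases Nat.eq_zero_or_pos (sparsity n fun x => p.eval ((∑ j, x j) / n)) with h | h
  · rw [h, Nat.cast_zero, Real.log_zero]
    have : (0 : ℝ) ≤ Real.log (n + 1) := Real.log_nonneg (by simp)
    positivity
  · rw [← Real.log_pow]
    exact Real.log_le_log (by exact_mod_cast h) (by exact_mod_cast hcard)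

lemma sum_cubeFourier_singleton (n : ℕ) (f : (Fin n → ℝ) → ℝ) :
    ∑ j, cubeFourier n f {j} = (∑ x ∈ cube n, (∑ j, x j) * f x) / 2 ^ n := by
  simp only [cubeFourier, Finset.prod_singleton, smul_eq_mul, Finset.sum_mul]
  rw [← Finset.mul_sum, Finset.sum_comm, div_eq_inv_mul]

lemma abs_sum_div_le_one_of_mem_cube {n : ℕ} {x : Fin n → ℝ} (hx : x ∈ cube n) :
    |(∑ j, x j) / n| ≤ 1 := by
  have h : |∑ j, x j| ≤ n := by
    refine (Finset.abs_sum_le_sum_abs _ _).trans ?_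
    have h1 (j : Fin n) : |x j| = 1 := by
      rw [← sq_eq_sq₀ (abs_nonneg _) zero_le_one, sq_abs, sq_eq_one_of_mem_cube hx, one_pow]
    simp [h1]
  rw [abs_div, Nat.abs_cast]
  exact div_le_one_of_le₀ h (Nat.cast_nonneg n)

/-- The odd Chebyshev polynomial `T_{2m+1}`, with the sign making its slope at `0` positive. -/
def signedT (m : ℕ) : Polynomial ℝ :=
  Polynomial.C ((-1) ^ m) * Polynomial.Chebyshev.T ℝ (2 * m + 1 : ℕ)

lemma eval_signedT_sin (m : ℕ) (φ : ℝ) :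
    (signedT m).eval (sin φ) = sin ((2 * m + 1 : ℕ) * φ) := by
  have h : ((2 * m + 1 : ℕ) : ℤ) * (π / 2 - φ) =
      (π / 2 - (2 * m + 1 : ℕ) * φ) + m * π := by
    push_cast
    ring
  rw [signedT, Polynomial.eval_mul, Polynomial.eval_C, ← Real.cos_pi_div_two_sub φ,
    Polynomial.Chebyshev.T_real_cos, h, Real.cos_add_nat_mul_pi, Real.cos_pi_div_two_sub,
    ← mul_assoc, ← mul_pow]
  norm_num

lemma abs_eval_signedT_le_one (m : ℕ) {y : ℝ} (hy : |y| ≤ 1) : |(signedT m).eval y| ≤ 1 := by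
  rw [← Real.sin_arcsin (abs_le.mp hy).1 (abs_le.mp hy).2, eval_signedT_sin]
  exact Real.abs_sin_le_one _

lemma natDegree_signedT_le (m : ℕ) : (signedT m).natDegree ≤ 2 * m + 1 := by
  refine (Polynomial.natDegree_C_mul_le _ _).trans ?_
  simp [Polynomial.Chebyshev.natDegree_T]
  omega

lemma eval_signedT_neg (m : ℕ) {y : ℝ} (hy : |y| ≤ 1) :
    (signedT m).eval (-y) = -(signedT m).eval y := by
  rw [← Real.sin_arcsin (abs_le.mp hy).1 (abs_le.mp hy).2, ← Real.sin_neg, eval_signedT_sin,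
    eval_signedT_sin, mul_neg, Real.sin_neg]

lemma le_eval_signedT (m : ℕ) {y : ℝ} (h0 : 0 ≤ y) (h1 : y ≤ 1) :
    (2 * m + 1 : ℕ) * y - 2 * (2 * m + 1 : ℕ) ^ 3 * y ^ 3 ≤ (signedT m).eval y := by
  set d : ℝ := ((2 * m + 1 : ℕ) : ℝ)
  have hd : 0 ≤ d := Nat.cast_nonneg _
  have hφ0 : 0 ≤ arcsin y := Real.arcsin_nonneg.mpr h0
  have hs : sin (arcsin y) = y := Real.sin_arcsin (by linarith) h1
  have hy : y ≤ arcsin y := by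
    have := Real.sin_le hφ0
    rwa [hs] at this
  have hφ : arcsin y ≤ 2 * y := by
    have h := Real.mul_le_sin hφ0 (Real.arcsin_le_pi_div_two y)
    rw [hs, div_mul_eq_mul_div, div_le_iff₀ Real.pi_pos] at h
    nlinarith [Real.pi_le_four]
  have hsin : d * arcsin y - (d * arcsin y) ^ 3 / 6 ≤ sin (d * arcsin y) := by
    rcases (mul_nonneg hd hφ0).eq_or_lt with h | h
    · simp [← h]
    · exact (Real.sin_gt_sub_cube h).le
  have hcube : (d * arcsin y) ^ 3 ≤ (d * (2 * y)) ^ 3 := by gcongr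
  have hlin : d * y ≤ d * arcsin y := by gcongr
  have : 0 ≤ d ^ 3 * y ^ 3 := by positivity
  rw [← hs, eval_signedT_sin, hs]
  nlinarith

lemma le_mul_eval_signedT (m : ℕ) {y : ℝ} (hy : |y| ≤ 1) :
    (2 * m + 1 : ℕ) * y ^ 2 - 2 * (2 * m + 1 : ℕ) ^ 3 * y ^ 4 ≤ y * (signedT m).eval y := by
  wlog h0 : 0 ≤ y generalizing y
  · have := this (y := -y) (by rwa [abs_neg]) (by linarith)
    rw [eval_signedT_neg m hy] at this
    linear_combination this
  · have := mul_le_mul_of_nonneg_left (le_eval_signedT m h0 (abs_le.mp hy).2) h0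
    linear_combination this

lemma le_sum_cubeFourier_signedT {n : ℕ} (hn : 1 ≤ n) (m : ℕ) :
    (2 * m + 1 : ℕ) - 6 * (2 * m + 1 : ℕ) ^ 3 / n ≤
      ∑ j, cubeFourier n (fun x => (signedT m).eval ((∑ j, x j) / n)) {j} := by
  have hn0 : (0 : ℝ) < n := by exact_mod_cast hn
  set d : ℝ := ((2 * m + 1 : ℕ) : ℝ)
  have hd : 0 ≤ d := Nat.cast_nonneg _
  rw [sum_cubeFourier_singleton, le_div_iff₀ (by positivity)]
  have hpt : ∑ x ∈ cube n, (d / n * (∑ j, x j) ^ 2 - 2 * d ^ 3 / n ^ 3 * (∑ j, x j) ^ 4) ≤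
      ∑ x ∈ cube n, (∑ j, x j) * (signedT m).eval ((∑ j, x j) / n) := by
    refine Finset.sum_le_sum fun x hx => ?_
    have h := mul_le_mul_of_nonneg_left
      (le_mul_eval_signedT m (abs_sum_div_le_one_of_mem_cube hx)) hn0.le
    convert h using 1
    · change d / n * (∑ j, x j) ^ 2 - 2 * d ^ 3 / n ^ 3 * (∑ j, x j) ^ 4 =
        n * (d * ((∑ j, x j) / n) ^ 2 - 2 * d ^ 3 * ((∑ j, x j) / n) ^ 4)
      field_simp
    · field_simp
  refine le_trans ?_ hpt
  rw [Finset.sum_sub_distrib, ← Finset.mul_sum, ← Finset.mul_sum, sum_cube_sum_sq]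
  have h4 := mul_le_mul_of_nonneg_left (sum_cube_sum_pow_four_le n)
    (show 0 ≤ 2 * d ^ 3 / (n : ℝ) ^ 3 by positivity)
  refine le_trans (le_of_eq ?_) (sub_le_sub_left h4 _)
  field_simp
  ring

lemma sum_cubeFourier_signedT_zero {n : ℕ} (hn : 1 ≤ n) :
    ∑ j, cubeFourier n (fun x => (signedT 0).eval ((∑ j, x j) / n)) {j} = 1 := by
  have hn0 : (n : ℝ) ≠ 0 := by positivity
  have h (x : Fin n → ℝ) : (∑ j, x j) * ((∑ j, x j) / n) = (∑ j, x j) ^ 2 / n := by ring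
  simp [sum_cubeFourier_singleton, signedT, h, ← Finset.sum_div, sum_cube_sum_sq, hn0]

lemma exists_signedT_linear_mass {n : ℕ} (hn : 1 ≤ n) :
    ∃ m : ℕ, ((2 * m + 1 : ℕ) : ℝ) ≤ √n ∧
      1 / 60 * √n ≤ ∑ j, cubeFourier n (fun x => (signedT m).eval ((∑ j, x j) / n)) {j} := by
  have hn0 : (0 : ℝ) < n := by exact_mod_cast hn
  have hsq : √(n : ℝ) ^ 2 = n := Real.sq_sqrt hn0.le
  rcases le_total (√(n : ℝ)) 60 with h | h
  · refine ⟨0, ?_, ?_⟩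
    · simpa using hn
    · rw [sum_cubeFourier_signedT_zero hn]
      linarith
  · have hlb := Nat.le_ceil (√(n : ℝ) / 40)
    have hub := Nat.ceil_lt_add_one (show 0 ≤ √(n : ℝ) / 40 by positivity)
    refine ⟨⌈√(n : ℝ) / 40⌉₊, ?_, le_trans ?_ (le_sum_cubeFourier_signedT hn _)⟩
    · push_cast
      linarith
    · set d : ℝ := ((2 * ⌈√(n : ℝ) / 40⌉₊ + 1 : ℕ) : ℝ) with hd
      push_cast at hd
      have hd1 : √(n : ℝ) / 20 ≤ d := by linarith
      have hd2 : d ≤ √(n : ℝ) / 10 := by linarith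
      have hd0 : 0 ≤ d := le_trans (by positivity) hd1
      have hdn : d ^ 2 ≤ n / 100 := by
        calc d ^ 2 ≤ (√(n : ℝ) / 10) ^ 2 := by gcongr
          _ = (n : ℝ) / 100 := by rw [div_pow, hsq]; norm_num
      have : 6 * d ^ 3 / n ≤ d / 2 := by
        rw [div_le_iff₀ hn0]
        nlinarith [mul_le_mul_of_nonneg_left hdn hd0, mul_nonneg hd0 hn0.le]
      linarith

/-- Sharpness (up to a `log n` factor) of the spectrum restriction for bounded
functions: a `[-1,1]`-valued function with linear Fourier mass `≥ c√n` and
`log` sparsity `≤ C√n·log(n+1)`. -/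
theorem log_sparsity_bound_sharp :
    ∃ C : ℝ, 0 < C ∧ ∃ c : ℝ, 0 < c ∧
      ∀ n : ℕ, 1 ≤ n →
        ∃ f : (Fin n → ℝ) → ℝ,
          (∀ x ∈ cube n, f x ∈ Set.Icc (-1 : ℝ) 1) ∧
          (∑ j : Fin n, |cubeFourier n f {j}|) ≥ c * Real.sqrt n ∧
          Real.log (sparsity n f : ℝ) ≤ C * Real.sqrt n * Real.log (n + 1) := by
  refine ⟨1, one_pos, 1 / 60, by norm_num, fun n hn => ?_⟩
  obtain ⟨m, hm, hmass⟩ := exists_signedT_linear_mass hn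
  refine ⟨fun x => (signedT m).eval ((∑ j, x j) / n), fun x hx => ?_, ?_, ?_⟩
  · exact abs_le.mp (abs_eval_signedT_le_one m (abs_sum_div_le_one_of_mem_cube hx))
  · exact hmass.trans (Finset.sum_le_sum fun j _ => le_abs_self _)
  · refine (log_sparsity_polynomial_sum_le _ (natDegree_signedT_le m)).trans ?_
    rw [one_mul]
    exact mul_le_mul_of_nonneg_right hm (Real.log_nonneg (by simp))
end
end

section
/- For every odd integer ℓ > 0, every n, m ≥ 1, every norm ‖·‖ on ℝ^m, and every function f : {-1,1}^n → ℝ^m, with X uniform on {-1,1}^n: (E[‖Rad f(X)‖²])^{1/2} ≤ 8ℓ·(1 + √m/2^ℓ)·(E[‖f(X)‖²])^{1/2}. -/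
open Finset Real

noncomputable section

/-- The nodes `(2k+1)π/(2N)` of M. Riesz's interpolation formula for the derivative at `0` of a
trigonometric polynomial of degree at most `N`. -/
def rieszNode (N k : ℕ) : ℝ := (2 * k + 1) * π / (2 * N)

/-- The weights of M. Riesz's interpolation formula. -/
def rieszWeight (N k : ℕ) : ℝ := (-1) ^ k / (4 * N * sin (rieszNode N k / 2) ^ 2)

lemma sin_half_rieszNode_pos {N k : ℕ} (hk : k < 2 * N) : 0 < sin (rieszNode N k / 2) := by
  have hN : (0 : ℝ) < N := by exact_mod_cast (by omega : 0 < N)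
  have hk' : (2 * k + 1 : ℝ) < 4 * N := by exact_mod_cast (by omega : 2 * k + 1 < 4 * N)
  apply sin_pos_of_pos_of_lt_pi
  · unfold rieszNode; positivity
  · unfold rieszNode
    rw [div_div, div_lt_iff₀ (by positivity)]
    nlinarith [pi_pos]

lemma mul_rieszNode {N : ℕ} (hN : 0 < N) (k : ℕ) : N * rieszNode N k = k * π + π / 2 := by
  have hN' : (N : ℝ) ≠ 0 := by positivity
  unfold rieszNode
  field_simp

lemma sin_mul_rieszNode {N : ℕ} (hN : 0 < N) (k : ℕ) : sin (N * rieszNode N k) = (-1) ^ k := by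
  rw [mul_rieszNode hN, sin_add_pi_div_two, cos_nat_mul_pi]

lemma cos_mul_rieszNode {N : ℕ} (hN : 0 < N) (k : ℕ) : cos (N * rieszNode N k) = 0 := by
  rw [mul_rieszNode hN, cos_add_pi_div_two, sin_nat_mul_pi, neg_zero]

lemma two_cos_mul_alternating_sum_sin (a : ℝ) (M : ℕ) :
    2 * cos a * ∑ k ∈ range M, (-1) ^ k * sin ((2 * k + 1) * a) =
      -((-1) ^ M * sin (2 * M * a)) := by
  induction M with
  | zero => simp
  | succ M ih =>
    rw [sum_range_succ, mul_add, ih]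
    have h₁ : 2 * ((M + 1 : ℕ) : ℝ) * a = (2 * M + 1) * a + a := by push_cast; ring
    have h₂ : 2 * (M : ℝ) * a = (2 * M + 1) * a - a := by ring
    rw [h₁, h₂, sin_add, sin_sub]
    ring

lemma alternating_sum_sin_rieszNode {N j : ℕ} (hj : 0 < j) (hjN : j < N) :
    ∑ k ∈ range (2 * N), (-1) ^ k * sin (j * rieszNode N k) = 0 := by
  have hN : (0 : ℝ) < N := by exact_mod_cast (by omega : 0 < N)
  have hj' : (0 : ℝ) < j := by exact_mod_cast hj
  have hjN' : (j : ℝ) < N := by exact_mod_cast hjN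
  have hcos : 0 < cos (j * π / (2 * N)) := by
    apply cos_pos_of_mem_Ioo
    constructor
    · have : 0 < j * π / (2 * N) := by positivity
      linarith [pi_pos]
    · rw [div_lt_div_iff₀ (by positivity) two_pos]
      nlinarith [pi_pos]
  have h := two_cos_mul_alternating_sum_sin (j * π / (2 * N)) (2 * N)
  have h₀ : 2 * ((2 * N : ℕ) : ℝ) * (j * π / (2 * N)) = ((2 * j : ℕ) : ℝ) * π := by
    push_cast; field_simp
  rw [h₀, sin_nat_mul_pi, mul_zero, neg_zero] at h
  have h' := (mul_eq_zero.mp h).resolve_left (by positivity)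
  rw [← h']
  refine sum_congr rfl fun k _ => ?_
  congr 2
  unfold rieszNode
  ring

lemma sin_add_sin_eq (x θ : ℝ) :
    sin (x + θ) + sin (x - θ) = 2 * sin x - 4 * sin (θ / 2) ^ 2 * sin x := by
  have h : cos θ = 1 - 2 * sin (θ / 2) ^ 2 := by
    have := cos_two_mul' (θ / 2)
    rw [mul_div_cancel₀ _ two_ne_zero] at this
    linarith [sin_sq_add_cos_sq (θ / 2)]
  rw [sin_add, sin_sub, h]
  ring

lemma rieszWeight_mul_sin_sq {N k : ℕ} (hk : k < 2 * N) :
    4 * sin (rieszNode N k / 2) ^ 2 * rieszWeight N k = (-1) ^ k / N := by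
  have h := (sin_half_rieszNode_pos hk).ne'
  have hN : (N : ℝ) ≠ 0 := by exact_mod_cast (by omega : N ≠ 0)
  unfold rieszWeight
  field_simp

lemma rieszSum_second_difference (N : ℕ) (j : ℝ) :
    ∑ k ∈ range (2 * N), rieszWeight N k * sin ((j + 1) * rieszNode N k) +
        ∑ k ∈ range (2 * N), rieszWeight N k * sin ((j - 1) * rieszNode N k) =
      2 * ∑ k ∈ range (2 * N), rieszWeight N k * sin (j * rieszNode N k) -
        (∑ k ∈ range (2 * N), (-1) ^ k * sin (j * rieszNode N k)) / N := by
  rw [mul_sum, sum_div, ← sum_add_distrib, ← sum_sub_distrib]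
  refine sum_congr rfl fun k hk => ?_
  have h₁ := rieszWeight_mul_sin_sq (mem_range.mp hk)
  have h₂ := sin_add_sin_eq (j * rieszNode N k) (rieszNode N k)
  rw [add_mul, sub_mul, one_mul, ← mul_add, h₂]
  linear_combination (-sin (j * rieszNode N k)) * h₁

lemma rieszSum_sin_sub {N : ℕ} (hN : 0 < N) :
    ∑ k ∈ range (2 * N), rieszWeight N k * sin (N * rieszNode N k) -
      ∑ k ∈ range (2 * N), rieszWeight N k * sin ((N - 1) * rieszNode N k) = 1 := by
  have h := rieszSum_second_difference N N
  have h₁ : ∑ k ∈ range (2 * N), (-1) ^ k * sin (N * rieszNode N k) = 2 * N := by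
    simp [sin_mul_rieszNode hN, ← mul_pow]
  have h₂ : ∑ k ∈ range (2 * N), rieszWeight N k * sin ((N + 1) * rieszNode N k) =
      ∑ k ∈ range (2 * N), rieszWeight N k * sin ((N - 1) * rieszNode N k) := by
    refine sum_congr rfl fun k _ => ?_
    rw [add_mul, sub_mul, one_mul, sin_add, sin_sub, cos_mul_rieszNode hN]
    ring
  have hN' : (N : ℝ) ≠ 0 := by positivity
  rw [h₁, h₂, mul_div_cancel_right₀ _ hN'] at h
  linarith

lemma rieszSum_sin {N j : ℕ} (hN : 0 < N) (hj : j ≤ N) :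
    ∑ k ∈ range (2 * N), rieszWeight N k * sin (j * rieszNode N k) = j := by
  set S : ℝ → ℝ := fun j => ∑ k ∈ range (2 * N), rieszWeight N k * sin (j * rieszNode N k)
    with hS
  have hlin : ∀ j : ℕ, j < N → S j = j * S 1 ∧ S (j + 1) = (j + 1) * S 1 := by
    intro j
    induction j with
    | zero => intro _; simp [hS]
    | succ j ih =>
      intro hj
      obtain ⟨h₁, h₂⟩ := ih (by omega)
      have h := rieszSum_second_difference N ((j + 1 : ℕ) : ℝ)
      rw [alternating_sum_sin_rieszNode (by omega) hj] at h
      change S _ + S _ = 2 * S _ - 0 / N at h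
      push_cast at h ⊢
      rw [add_sub_cancel_right, h₁, h₂] at h
      rw [zero_div] at h
      exact ⟨h₂, by linarith⟩
  obtain ⟨M, rfl⟩ : ∃ M, N = M + 1 := ⟨N - 1, by omega⟩
  have h₁ : S 1 = 1 := by
    have h := rieszSum_sin_sub hN
    change S _ - S _ = 1 at h
    obtain ⟨h₁, h₂⟩ := hlin M (by omega)
    push_cast at h
    rw [add_sub_cancel_right, h₁, h₂] at h
    linarith
  change S j = j
  rcases hj.lt_or_eq with hlt | rfl
  · rw [(hlin j hlt).1, h₁, mul_one]
  · push_cast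
    rw [(hlin M (by omega)).2, h₁, mul_one]

lemma rieszSum_sin_int {N : ℕ} (hN : 0 < N) {j : ℤ} (hj : |j| ≤ N) :
    ∑ k ∈ range (2 * N), rieszWeight N k * sin (j * rieszNode N k) = j := by
  obtain ⟨i, rfl | rfl⟩ := j.eq_nat_or_neg
  · simpa using rieszSum_sin hN (j := i) (by simpa using hj)
  · simpa using rieszSum_sin hN (j := i) (by simpa using hj)

lemma rieszSum_cos_int {N : ℕ} (hN : 0 < N) (j : ℤ) :
    ∑ k ∈ range (2 * N), rieszWeight N k * cos (j * rieszNode N k) = 0 := by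
  have hN' : (N : ℝ) ≠ 0 := by positivity
  have h : ∑ k ∈ range (2 * N), rieszWeight N k * cos (j * rieszNode N k) =
      -∑ k ∈ range (2 * N), rieszWeight N k * cos (j * rieszNode N k) := by
    conv_lhs => rw [← sum_range_reflect]
    rw [← sum_neg_distrib]
    refine sum_congr rfl fun k hk => ?_
    have hk' := mem_range.mp hk
    have hnode : rieszNode N (2 * N - 1 - k) = 2 * π - rieszNode N k := by
      have : ((2 * N - 1 - k : ℕ) : ℝ) = 2 * N - 1 - k := by
        rw [Nat.cast_sub (by omega), Nat.cast_sub (by omega)]; push_cast; ring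
      unfold rieszNode
      rw [this]
      field_simp
      ring
    have hsign : (-1 : ℝ) ^ (2 * N - 1 - k) = -(-1) ^ k := by
      have h₂ : (-1 : ℝ) ^ (2 * N - 1 - k) * (-1) ^ (k + 1) = 1 := by
        rw [← pow_add, show 2 * N - 1 - k + (k + 1) = 2 * N by omega, pow_mul]
        simp
      have h₃ : (-1 : ℝ) ^ k * (-1) ^ k = 1 := by simp [← mul_pow]
      rw [pow_succ] at h₂
      linear_combination (-(-1) ^ k) * h₂ - (-1) ^ (2 * N - 1 - k) * h₃
    have hcos : cos (j * (2 * π - rieszNode N k)) = cos (j * rieszNode N k) := by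
      rw [mul_sub, cos_int_mul_two_pi_sub]
    rw [hnode, hcos]
    unfold rieszWeight
    rw [hnode, hsign, show (2 * π - rieszNode N k) / 2 = π - rieszNode N k / 2 by ring, sin_pi_sub]
    ring
  linarith

lemma rieszSum_sin_pow_mul {N : ℕ} (hN : 0 < N) (i : ℕ) : ∀ j : ℤ, |j| + i ≤ N →
    (∑ k ∈ range (2 * N), rieszWeight N k * (sin (rieszNode N k) ^ i * sin (j * rieszNode N k)) =
      if i = 0 then (j : ℝ) else 0) ∧
    (∑ k ∈ range (2 * N), rieszWeight N k * (sin (rieszNode N k) ^ i * cos (j * rieszNode N k)) =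
      if i = 1 then 1 else 0) := by
  induction i with
  | zero =>
    intro j hj
    simpa using ⟨rieszSum_sin_int hN (by simpa using hj), rieszSum_cos_int hN j⟩
  | succ i ih =>
    intro j hj
    push_cast at hj
    obtain ⟨hs₁, hc₁⟩ := ih (j + 1) (by have := abs_add_le j 1; simp at this; omega)
    obtain ⟨hs₂, hc₂⟩ := ih (j - 1) (by have := abs_sub j 1; simp at this; omega)
    push_cast at hs₁ hs₂ hc₁ hc₂
    constructor
    · calc _ = (∑ k ∈ range (2 * N),
              rieszWeight N k * (sin (rieszNode N k) ^ i * cos ((j - 1) * rieszNode N k)) -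
            ∑ k ∈ range (2 * N),
              rieszWeight N k * (sin (rieszNode N k) ^ i * cos ((j + 1) * rieszNode N k))) / 2 := by
            rw [← sum_sub_distrib, sum_div]
            refine sum_congr rfl fun k _ => ?_
            rw [add_mul, sub_mul, one_mul, cos_add, cos_sub]
            ring
        _ = _ := by rw [hc₁, hc₂]; simp
    · calc _ = (∑ k ∈ range (2 * N),
              rieszWeight N k * (sin (rieszNode N k) ^ i * sin ((j + 1) * rieszNode N k)) -
            ∑ k ∈ range (2 * N),
              rieszWeight N k * (sin (rieszNode N k) ^ i * sin ((j - 1) * rieszNode N k))) / 2 := by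
            rw [← sum_sub_distrib, sum_div]
            refine sum_congr rfl fun k _ => ?_
            rw [add_mul, sub_mul, one_mul, sin_add, sin_sub]
            ring
        _ = _ := by
            rw [hs₁, hs₂]
            by_cases hi : i = 0
            · simp [hi]
            · simp [hi]

lemma rieszSum_sin_pow {N i : ℕ} (hN : 0 < N) (hi : i ≤ N) :
    ∑ k ∈ range (2 * N), rieszWeight N k * sin (rieszNode N k) ^ i = if i = 1 then 1 else 0 := by
  simpa using (rieszSum_sin_pow_mul hN i 0 (by simpa using hi)).2

lemma sum_abs_rieszWeight {N : ℕ} (hN : 0 < N) :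
    ∑ k ∈ range (2 * N), |rieszWeight N k| = N := by
  rw [← rieszSum_sin hN le_rfl]
  refine sum_congr rfl fun k _ => ?_
  rw [sin_mul_rieszNode hN]
  unfold rieszWeight
  rw [abs_div, abs_pow, abs_neg, abs_one, one_pow, abs_of_nonneg (by positivity), div_mul_eq_mul_div,
    ← mul_pow]
  simp

/-- A signed measure on `[-1/2, 1/2]` of mass at most `2N` whose moments are those of the linear
functional `p ↦ p'(0)` up to degree `N`, and small beyond. -/
lemma exists_linear_proxy {N : ℕ} (hN : 0 < N) : ∃ w t : ℕ → ℝ,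
    (∑ k ∈ range (2 * N), |w k| = 2 * N) ∧ (∀ k, |t k| ≤ 1) ∧
    ∀ i, |∑ k ∈ range (2 * N), w k * t k ^ i - if i = 1 then 1 else 0| ≤ N / 2 ^ N := by
  refine ⟨fun k => 2 * rieszWeight N k, fun k => sin (rieszNode N k) / 2, ?_, ?_, ?_⟩
  · simp only [abs_mul, ← mul_sum, sum_abs_rieszWeight hN, abs_two]
  · intro k
    rw [abs_div, abs_two]
    linarith [abs_sin_le_one (rieszNode N k)]
  · intro i
    have hsum : ∑ k ∈ range (2 * N), 2 * rieszWeight N k * (sin (rieszNode N k) / 2) ^ i =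
        2 / 2 ^ i * ∑ k ∈ range (2 * N), rieszWeight N k * sin (rieszNode N k) ^ i := by
      rw [mul_sum]
      refine sum_congr rfl fun k _ => ?_
      rw [div_pow]
      ring
    rw [hsum]
    rcases le_or_gt i N with hi | hi
    · rw [rieszSum_sin_pow hN hi]
      have : 2 / 2 ^ i * (if i = 1 then (1 : ℝ) else 0) - (if i = 1 then 1 else 0) = 0 := by
        split_ifs with h <;> simp [h]
      rw [this, abs_zero]
      positivity
    · rw [if_neg (by omega), sub_zero, abs_mul, abs_of_pos (by positivity)]
      have hle : |∑ k ∈ range (2 * N), rieszWeight N k * sin (rieszNode N k) ^ i| ≤ N := by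
        rw [← sum_abs_rieszWeight hN]
        refine (abs_sum_le_sum_abs _ _).trans (sum_le_sum fun k _ => ?_)
        rw [abs_mul, abs_pow]
        exact mul_le_of_le_one_right (abs_nonneg _)
          (pow_le_one₀ (abs_nonneg _) (abs_sin_le_one _))
      have hpow : (2 : ℝ) / 2 ^ i ≤ 1 / 2 ^ N := by
        rw [div_le_div_iff₀ (by positivity) (by positivity), one_mul, ← pow_succ']
        exact pow_le_pow_right₀ one_le_two hi
      calc _ ≤ 1 / 2 ^ N * (N : ℝ) := by gcongr
        _ = _ := by ring

/-- **Auerbach's lemma**: a finite-dimensional normed space has a basis of vectors of norm at most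
`1` whose coordinate functionals have norm at most `1`. -/
lemma exists_auerbach_basis (E : Type*) [NormedAddCommGroup E] [NormedSpace ℝ E]
    [FiniteDimensional ℝ E] : ∃ b : Module.Basis (Fin (Module.finrank ℝ E)) ℝ E,
      (∀ i, ‖b i‖ ≤ 1) ∧ ∀ i x, |b.repr x i| ≤ ‖x‖ := by
  have : ProperSpace E := FiniteDimensional.proper_real E
  let e := Module.finBasis ℝ E
  let K : Set (Fin (Module.finrank ℝ E) → E) := Set.univ.pi fun _ => Metric.closedBall 0 1
  have hK : IsCompact K := isCompact_univ_pi fun _ => isCompact_closedBall 0 1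
  have hcont : Continuous fun v => |e.det v| := by
    simp only [Module.Basis.det_apply]
    refine (Continuous.matrix_det (continuous_matrix fun i j => ?_)).abs
    exact (LinearMap.continuous_of_finiteDimensional (e.coord i)).comp (continuous_apply j)
  obtain ⟨v, hvK, hv⟩ := hK.exists_isMaxOn ⟨0, by simp [K, Set.mem_pi]⟩ hcont.continuousOn
  have hpos : 0 < |e.det v| := by
    refine lt_of_lt_of_le ?_ (hv (a := fun i => ‖e i‖⁻¹ • e i) ?_)
    · have h := e.det.map_smul_univ (fun i => ‖e i‖⁻¹) e
      change 0 < |e.det fun i => ‖e i‖⁻¹ • e i|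
      rw [h, e.det_self]
      have : ∏ i, ‖e i‖⁻¹ ≠ 0 :=
        prod_ne_zero_iff.mpr fun i _ => inv_ne_zero (norm_ne_zero_iff.mpr (e.ne_zero i))
      simpa using this
    · intro i _
      simp [norm_smul, e.ne_zero i]
  obtain ⟨hli, hsp⟩ := e.is_basis_iff_det.mpr (abs_pos.mp hpos).isUnit
  have hball : ∀ i x, ‖x‖ ≤ 1 → |(Module.Basis.mk hli hsp.ge).coord i x| ≤ 1 := by
    intro i x hx
    have h := LinearMap.congr_fun (e.det_smul_mk_coord_eq_det_update hli hsp.ge i) x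
    have hmax : |e.det (Function.update v i x)| ≤ |e.det v| := by
      refine hv (a := Function.update v i x) fun j _ => ?_
      rcases eq_or_ne j i with rfl | hj
      · simpa using hx
      · simpa [hj] using hvK j trivial
    have h' : |e.det v| * |(Module.Basis.mk hli hsp.ge).coord i x| ≤ |e.det v| * 1 := by
      rw [← abs_mul, mul_one]
      refine le_trans (le_of_eq ?_) hmax
      exact congrArg abs h
    exact le_of_mul_le_mul_left h' hpos
  refine ⟨Module.Basis.mk hli hsp.ge, fun i => ?_, fun i x => ?_⟩
  · simpa using hvK i trivial
  · rcases eq_or_ne x 0 with rfl | hx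
    · rw [map_zero]
      simp
    · have hx' : 0 < ‖x‖ := norm_pos_iff.mpr hx
      have h := hball i (‖x‖⁻¹ • x) (by simp [norm_smul, hx])
      rw [map_smul, smul_eq_mul, abs_mul, abs_inv, abs_norm, inv_mul_le_iff₀ hx', mul_one] at h
      exact h

/-- **Schur's test** in `L²`, for vector-valued functions on a finite set. -/
lemma sum_sq_norm_kernel_le {α E : Type*} [NormedAddCommGroup E] [NormedSpace ℝ E] (s : Finset α)
    {κ A : α → α → ℝ} {C : ℝ} (hC : 0 ≤ C) (hA : ∀ x ∈ s, ∀ y ∈ s, |κ x y| ≤ A x y)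
    (hrow : ∀ x ∈ s, ∑ y ∈ s, A x y ≤ C) (hcol : ∀ y ∈ s, ∑ x ∈ s, A x y ≤ C) (f : α → E) :
    ∑ x ∈ s, ‖∑ y ∈ s, κ x y • f y‖ ^ 2 ≤ C ^ 2 * ∑ y ∈ s, ‖f y‖ ^ 2 := by
  have hA₀ : ∀ x ∈ s, ∀ y ∈ s, 0 ≤ A x y := fun x hx y hy => (abs_nonneg _).trans (hA x hx y hy)
  calc ∑ x ∈ s, ‖∑ y ∈ s, κ x y • f y‖ ^ 2
      ≤ ∑ x ∈ s, C * ∑ y ∈ s, A x y * ‖f y‖ ^ 2 := by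
        refine sum_le_sum fun x hx => ?_
        have h₁ : ‖∑ y ∈ s, κ x y • f y‖ ≤ ∑ y ∈ s, A x y * ‖f y‖ := by
          refine norm_sum_le_of_le s fun y hy => ?_
          rw [norm_smul]
          exact mul_le_mul_of_nonneg_right (hA x hx y hy) (norm_nonneg _)
        have h₂ : (∑ y ∈ s, A x y * ‖f y‖) ^ 2 ≤
            (∑ y ∈ s, A x y) * ∑ y ∈ s, A x y * ‖f y‖ ^ 2 :=
          sum_sq_le_sum_mul_sum_of_sq_le_mul s (hA₀ x hx)
            (fun y hy => mul_nonneg (hA₀ x hx y hy) (sq_nonneg _)) fun y _ => le_of_eq (by ring)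
        calc _ ≤ (∑ y ∈ s, A x y * ‖f y‖) ^ 2 := by gcongr
          _ ≤ _ := h₂
          _ ≤ _ := mul_le_mul_of_nonneg_right (hrow x hx)
            (sum_nonneg fun y hy => mul_nonneg (hA₀ x hx y hy) (sq_nonneg _))
    _ = C * ∑ y ∈ s, (∑ x ∈ s, A x y) * ‖f y‖ ^ 2 := by
        rw [← mul_sum, sum_comm]
        simp only [sum_mul]
    _ ≤ C * ∑ y ∈ s, C * ‖f y‖ ^ 2 := by
        gcongr with y hy
        exact hcol y hy
    _ = _ := by rw [← mul_sum]; ring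

lemma sum_sq_norm_add_le {α E : Type*} [SeminormedAddCommGroup E] {s : Finset α} {u v : α → E}
    {a b c : ℝ} (ha : 0 < a) (hb : 0 < b) (hu : ∑ x ∈ s, ‖u x‖ ^ 2 ≤ a ^ 2 * c)
    (hv : ∑ x ∈ s, ‖v x‖ ^ 2 ≤ b ^ 2 * c) :
    ∑ x ∈ s, ‖u x + v x‖ ^ 2 ≤ (a + b) ^ 2 * c := by
  have h : ∑ x ∈ s, ‖u x + v x‖ ^ 2 ≤
      ∑ x ∈ s, ((a + b) / a * ‖u x‖ ^ 2 + (a + b) / b * ‖v x‖ ^ 2) := by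
    refine sum_le_sum fun x _ => ?_
    calc _ ≤ (‖u x‖ + ‖v x‖) ^ 2 := by gcongr; exact norm_add_le _ _
      _ ≤ _ := by
        rw [← sub_nonneg]
        have : (a + b) / a * ‖u x‖ ^ 2 + (a + b) / b * ‖v x‖ ^ 2 - (‖u x‖ + ‖v x‖) ^ 2 =
            (b * ‖u x‖ - a * ‖v x‖) ^ 2 / (a * b) := by
          field_simp
          ring
        rw [this]
        positivity
  rw [sum_add_distrib, ← mul_sum, ← mul_sum] at h
  calc _ ≤ _ := h
    _ ≤ (a + b) / a * (a ^ 2 * c) + (a + b) / b * (b ^ 2 * c) := by gcongr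
    _ = _ := by field_simp

lemma abs_le_one_of_mem_cube {n : ℕ} {x : Fin n → ℝ} (hx : x ∈ cube n) (j : Fin n) :
    |x j| ≤ 1 := by
  have := Fintype.mem_piFinset.mp hx j
  simp only [mem_insert, mem_singleton] at this
  rcases this with h | h <;> simp [h]

lemma sum_cube_prod (n : ℕ) (u : Fin n → ℝ → ℝ) :
    ∑ x ∈ cube n, ∏ j, u j (x j) = ∏ j, (u j (-1) + u j 1) := by
  rw [cube, sum_prod_piFinset]
  exact prod_congr rfl fun j _ => sum_pair (by norm_num)

lemma sum_cube_character_mul {n : ℕ} (S T : Finset (Fin n)) :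
    ∑ x ∈ cube n, (∏ j ∈ S, x j) * ∏ j ∈ T, x j = if S = T then 2 ^ n else 0 := by
  have h := sum_cube_prod n fun j r => (if j ∈ S then r else 1) * (if j ∈ T then r else 1)
  simp only [prod_mul_distrib, prod_ite_mem, univ_inter] at h
  rw [h]
  split_ifs with hST
  · subst hST
    rw [prod_congr rfl (g := fun _ => (2 : ℝ))]
    · simp
    · intro j _
      split_ifs <;> norm_num
  · obtain ⟨j, hj⟩ : ∃ j, ¬(j ∈ S ↔ j ∈ T) := by
      by_contra! h
      exact hST (Finset.ext h)
    apply prod_eq_zero (mem_univ j)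
    by_cases h₁ : j ∈ S <;> by_cases h₂ : j ∈ T <;> simp_all

/-- The kernel of the noise operator that multiplies the character `χ_S` by `t ^ |S|`. -/
def noiseKernel {n : ℕ} (t : ℝ) (x y : Fin n → ℝ) : ℝ := ∏ j, (1 + t * (x j * y j))

lemma noiseKernel_comm {n : ℕ} (t : ℝ) (x y : Fin n → ℝ) :
    noiseKernel t x y = noiseKernel t y x := by
  simp only [noiseKernel, mul_comm (x _)]

lemma noiseKernel_nonneg {n : ℕ} {t : ℝ} (ht : |t| ≤ 1) {x y : Fin n → ℝ} (hx : x ∈ cube n)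
    (hy : y ∈ cube n) : 0 ≤ noiseKernel t x y := by
  refine prod_nonneg fun j _ => ?_
  have h : |t * (x j * y j)| ≤ 1 := by
    rw [abs_mul, abs_mul]
    exact mul_le_one₀ ht (by positivity) (mul_le_one₀ (abs_le_one_of_mem_cube hx j)
      (abs_nonneg _) (abs_le_one_of_mem_cube hy j))
  linarith [(abs_le.mp h).1]

lemma sum_noiseKernel {n : ℕ} (t : ℝ) (x : Fin n → ℝ) :
    ∑ y ∈ cube n, noiseKernel t x y = 2 ^ n := by
  have h := sum_cube_prod n fun j r => 1 + t * (x j * r)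
  rw [← Fin.prod_const n (2 : ℝ)]
  refine h.trans (prod_congr rfl fun j _ => ?_)
  ring

lemma noiseKernel_eq_sum {n : ℕ} (t : ℝ) (x y : Fin n → ℝ) :
    noiseKernel t x y = ∑ S : Finset (Fin n), t ^ #S * ((∏ j ∈ S, x j) * ∏ j ∈ S, y j) := by
  rw [noiseKernel, prod_one_add, powerset_univ]
  simp [prod_mul_distrib]

lemma sum_cube_sq_sum_character {n : ℕ} (b : Finset (Fin n) → ℝ) :
    ∑ x ∈ cube n, (∑ S, b S * ∏ j ∈ S, x j) ^ 2 = 2 ^ n * ∑ S, b S ^ 2 := by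
  calc _ = ∑ x ∈ cube n, ∑ S, ∑ T, b S * b T * ((∏ j ∈ S, x j) * ∏ j ∈ T, x j) := by
        refine sum_congr rfl fun x _ => ?_
        rw [sq, sum_mul_sum]
        exact sum_congr rfl fun S _ => sum_congr rfl fun T _ => by ring
    _ = ∑ S, ∑ T, b S * b T * ∑ x ∈ cube n, (∏ j ∈ S, x j) * ∏ j ∈ T, x j := by
        rw [sum_comm]
        refine sum_congr rfl fun S _ => ?_
        rw [sum_comm]
        simp only [mul_sum]
    _ = _ := by
        simp only [sum_cube_character_mul, mul_ite, mul_zero, sum_ite_eq, mem_univ, if_true]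
        rw [mul_sum]
        exact sum_congr rfl fun S _ => by ring

/-- **Bessel's inequality** for the characters of the cube. -/
lemma sum_cubeFourier_sq_le {n : ℕ} (g : (Fin n → ℝ) → ℝ) :
    2 ^ n * ∑ S, cubeFourier n g S ^ 2 ≤ ∑ x ∈ cube n, g x ^ 2 := by
  have h : 0 ≤ ∑ x ∈ cube n, (g x - ∑ S, cubeFourier n g S * ∏ j ∈ S, x j) ^ 2 :=
    sum_nonneg fun _ _ => sq_nonneg _
  have hcross : ∑ x ∈ cube n, g x * ∑ S, cubeFourier n g S * ∏ j ∈ S, x j =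
      2 ^ n * ∑ S, cubeFourier n g S ^ 2 := by
    simp only [mul_sum]
    rw [sum_comm]
    refine sum_congr rfl fun S _ => ?_
    have : ∑ x ∈ cube n, (∏ j ∈ S, x j) * g x = 2 ^ n * cubeFourier n g S := by
      simp [cubeFourier]
    rw [sq, mul_left_comm, ← this, mul_sum]
    exact sum_congr rfl fun x _ => by ring
  simp only [sub_sq, sum_add_distrib, sum_sub_distrib, mul_assoc, ← mul_sum,
    sum_cube_sq_sum_character, hcross] at h
  linarith

lemma sum_smul_kernel_eq {E : Type*} [AddCommGroup E] [Module ℝ E] {n : ℕ}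
    (d : Finset (Fin n) → ℝ) (f : (Fin n → ℝ) → E) (x : Fin n → ℝ) :
    ∑ y ∈ cube n, ((2 ^ n)⁻¹ * ∑ S, d S * ((∏ j ∈ S, x j) * ∏ j ∈ S, y j)) • f y =
      ∑ S, (d S * ∏ j ∈ S, x j) • cubeFourier n f S := by
  simp only [cubeFourier, smul_sum, mul_sum, sum_smul, smul_smul]
  rw [sum_comm]
  exact sum_congr rfl fun S _ => sum_congr rfl fun y _ => by congr 1; ring

lemma rad_eq_sum {E : Type*} [AddCommGroup E] [Module ℝ E] {n : ℕ}
    (f : (Fin n → ℝ) → E) (x : Fin n → ℝ) :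
    rad n f x = ∑ S : Finset (Fin n),
      ((if #S = 1 then 1 else 0) * ∏ j ∈ S, x j) • cubeFourier n f S := by
  simp only [ite_mul, one_mul, zero_mul, ite_smul, zero_smul]
  rw [← sum_filter, univ_filter_card_eq, powersetCard_one, sum_map]
  simp [rad]

lemma sum_sq_multiplier_le {n : ℕ} {d : Finset (Fin n) → ℝ} {ε : ℝ} (hd : ∀ S, |d S| ≤ ε)
    (g : (Fin n → ℝ) → ℝ) :
    ∑ x ∈ cube n, (∑ S, (d S * ∏ j ∈ S, x j) • cubeFourier n g S) ^ 2 ≤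
      ε ^ 2 * ∑ x ∈ cube n, g x ^ 2 := by
  calc _ = 2 ^ n * ∑ S, (d S * cubeFourier n g S) ^ 2 := by
        rw [← sum_cube_sq_sum_character]
        refine sum_congr rfl fun x _ => ?_
        congr 1
        exact sum_congr rfl fun S _ => by rw [smul_eq_mul]; ring
    _ ≤ 2 ^ n * ∑ S, ε ^ 2 * cubeFourier n g S ^ 2 := by
        gcongr with S
        rw [mul_pow]
        exact mul_le_mul_of_nonneg_right (sq_le_sq' (abs_le.mp (hd S)).1 (abs_le.mp (hd S)).2)
          (sq_nonneg _)
    _ ≤ _ := by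
        rw [← mul_sum, mul_left_comm]
        exact mul_le_mul_of_nonneg_left (sum_cubeFourier_sq_le g) (sq_nonneg _)

section NormedSpace

variable {E : Type*} [NormedAddCommGroup E] [NormedSpace ℝ E] {n : ℕ}

lemma map_cubeFourier (φ : E →ₗ[ℝ] ℝ) (f : (Fin n → ℝ) → E) (S : Finset (Fin n)) :
    φ (cubeFourier n f S) = cubeFourier n (fun x => φ (f x)) S := by
  simp [cubeFourier, map_sum]

lemma sum_sq_norm_multiplier_le [FiniteDimensional ℝ E] {d : Finset (Fin n) → ℝ} {ε : ℝ}
    (hd : ∀ S, |d S| ≤ ε) (f : (Fin n → ℝ) → E) :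
    ∑ x ∈ cube n, ‖∑ S, (d S * ∏ j ∈ S, x j) • cubeFourier n f S‖ ^ 2 ≤
      (Module.finrank ℝ E * ε) ^ 2 * ∑ x ∈ cube n, ‖f x‖ ^ 2 := by
  obtain ⟨b, hb, hcoord⟩ := exists_auerbach_basis E
  have hnorm : ∀ z, ‖z‖ ^ 2 ≤ Module.finrank ℝ E * ∑ i, b.coord i z ^ 2 := by
    intro z
    have h : ‖z‖ ≤ ∑ i, |b.coord i z| := by
      conv_lhs => rw [← b.sum_repr z]
      refine norm_sum_le_of_le _ fun i _ => ?_
      rw [norm_smul]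
      exact mul_le_of_le_one_right (norm_nonneg _) (hb i)
    calc ‖z‖ ^ 2 ≤ (∑ i, |b.coord i z|) ^ 2 := by gcongr
      _ ≤ _ := sq_sum_le_card_mul_sum_sq
      _ = _ := by simp
  calc _ ≤ ∑ x ∈ cube n, Module.finrank ℝ E * ∑ i,
          b.coord i (∑ S, (d S * ∏ j ∈ S, x j) • cubeFourier n f S) ^ 2 :=
        sum_le_sum fun x _ => hnorm _
    _ = Module.finrank ℝ E * ∑ i, ∑ x ∈ cube n, (∑ S, (d S * ∏ j ∈ S, x j) •
          cubeFourier n (fun y => b.coord i (f y)) S) ^ 2 := by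
        rw [← mul_sum, sum_comm]
        simp only [map_sum, map_smul, map_cubeFourier]
    _ ≤ Module.finrank ℝ E * ∑ _i : Fin (Module.finrank ℝ E),
          ε ^ 2 * ∑ x ∈ cube n, ‖f x‖ ^ 2 := by
        gcongr with i _
        refine (sum_sq_multiplier_le hd _).trans ?_
        refine mul_le_mul_of_nonneg_left (sum_le_sum fun x _ => ?_) (sq_nonneg _)
        exact sq_le_sq' (abs_le.mp (hcoord i (f x))).1 (abs_le.mp (hcoord i (f x))).2
    _ = _ := by
        rw [sum_const, card_univ, Fintype.card_fin, nsmul_eq_mul]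
        ring

/-- Boundedness of the Rademacher projection, with a constant depending on a free parameter. -/
lemma sum_sq_norm_rad_le [FiniteDimensional ℝ E] (hE : 0 < Module.finrank ℝ E) {N : ℕ}
    (hN : 0 < N) (f : (Fin n → ℝ) → E) :
    ∑ x ∈ cube n, ‖rad n f x‖ ^ 2 ≤
      (2 * N + Module.finrank ℝ E * (N / 2 ^ N)) ^ 2 * ∑ x ∈ cube n, ‖f x‖ ^ 2 := by
  obtain ⟨w, t, hw, ht, hwt⟩ := exists_linear_proxy hN
  set c : Finset (Fin n) → ℝ := fun S => ∑ k ∈ range (2 * N), w k * t k ^ #S with hc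
  have hkernel : ∀ x y : Fin n → ℝ, ∑ k ∈ range (2 * N), w k * noiseKernel (t k) x y =
      ∑ S, c S * ((∏ j ∈ S, x j) * ∏ j ∈ S, y j) := by
    intro x y
    simp only [noiseKernel_eq_sum, mul_sum, hc, sum_mul]
    rw [sum_comm]
    simp only [mul_assoc]
  have hmain : ∑ x ∈ cube n, ‖∑ S, (c S * ∏ j ∈ S, x j) • cubeFourier n f S‖ ^ 2 ≤
      (2 * N) ^ 2 * ∑ x ∈ cube n, ‖f x‖ ^ 2 := by
    simp only [← sum_smul_kernel_eq, ← hkernel]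
    have hrow : ∀ x : Fin n → ℝ, ∑ y ∈ cube n,
        (2 ^ n)⁻¹ * ∑ k ∈ range (2 * N), |w k| * noiseKernel (t k) x y = 2 * N := by
      intro x
      rw [← mul_sum, sum_comm]
      simp only [← mul_sum, sum_noiseKernel]
      rw [← sum_mul, hw]
      field_simp
    refine sum_sq_norm_kernel_le (cube n) (by positivity) (fun x hx y hy => ?_)
      (fun x _ => (hrow x).le) (fun y _ => ?_) f
    · rw [abs_mul, abs_of_pos (by positivity)]
      refine mul_le_mul_of_nonneg_left ((abs_sum_le_sum_abs _ _).trans_eq ?_) (by positivity)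
      refine sum_congr rfl fun k _ => ?_
      rw [abs_mul, abs_of_nonneg (noiseKernel_nonneg (ht k) hx hy)]
    · simp only [noiseKernel_comm _ _ y]
      exact (hrow y).le
  have herr := sum_sq_norm_multiplier_le (d := fun S => (if #S = 1 then 1 else 0) - c S)
    (fun S => by rw [abs_sub_comm]; exact hwt #S) f
  refine le_trans (le_of_eq ?_) (sum_sq_norm_add_le (by positivity) (by positivity) hmain herr)
  refine sum_congr rfl fun x _ => ?_
  rw [rad_eq_sum, ← sum_add_distrib]
  congr 2
  refine sum_congr rfl fun S _ => ?_
  rw [← add_smul, ← add_mul, add_sub_cancel]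

end NormedSpace

/-- Trading `m` at one degree for `√m` at another. -/
lemma exists_degree_le {ℓ : ℕ} (hℓ : 0 < ℓ) (s : ℝ) (hs : 0 ≤ s) : ∃ N : ℕ, 0 < N ∧
    2 * N + s ^ 2 * (N / 2 ^ N) ≤ 8 * ℓ * (1 + s / 2 ^ ℓ) := by
  have hℓ' : (1 : ℝ) ≤ ℓ := by exact_mod_cast hℓ
  have hbound : ∀ L : ℕ, s ≤ 2 ^ L →
      2 * ((2 * L : ℕ) : ℝ) + s ^ 2 * ((2 * L : ℕ) / 2 ^ (2 * L)) ≤ 4 * L + 2 * L * (s / 2 ^ L) := by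
    intro L hL
    have h : s / 2 ^ L ≤ 1 := (div_le_one (by positivity)).mpr hL
    have h₀ : 0 ≤ s / 2 ^ L := by positivity
    have heq : 2 * ((2 * L : ℕ) : ℝ) + s ^ 2 * ((2 * L : ℕ) / 2 ^ (2 * L)) =
        4 * L + 2 * L * (s / 2 ^ L) ^ 2 := by
      push_cast
      rw [mul_comm 2 L, pow_mul, div_pow]
      ring
    rw [heq]
    gcongr
    nlinarith
  by_cases hs' : s ≤ 2 ^ ℓ
  · refine ⟨2 * ℓ, by omega, (hbound ℓ hs').trans ?_⟩
    have h₀ : 0 ≤ s / 2 ^ ℓ := by positivity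
    nlinarith [mul_nonneg (Nat.cast_nonneg (α := ℝ) ℓ) h₀]
  · have hex : ∃ d : ℕ, s ≤ 2 ^ (ℓ + d) := by
      obtain ⟨d, hd⟩ := pow_unbounded_of_one_lt s (one_lt_two (α := ℝ))
      exact ⟨d, hd.le.trans (pow_le_pow_right₀ one_le_two (by omega))⟩
    classical
    obtain ⟨d, hd⟩ : ∃ d, Nat.find hex = d + 1 :=
      ⟨Nat.find hex - 1, by have := (Nat.find_pos hex).mpr (by simpa using hs'); omega⟩
    have hle : s ≤ 2 ^ (ℓ + (d + 1)) := hd ▸ Nat.find_spec hex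
    have hlt : 2 ^ (ℓ + d) < s := not_le.mp (Nat.find_min hex (m := d) (by omega))
    refine ⟨2 * (ℓ + (d + 1)), by omega, (hbound _ hle).trans ?_⟩
    have h₁ : s / 2 ^ (ℓ + (d + 1)) ≤ 1 := (div_le_one (by positivity)).mpr hle
    have h₂ : (d + 1 : ℝ) ≤ s / 2 ^ ℓ := by
      rw [le_div_iff₀ (by positivity)]
      refine le_trans ?_ hlt.le
      rw [pow_add, mul_comm]
      gcongr
      exact_mod_cast Nat.lt_two_pow_self
    calc _ ≤ 4 * ((ℓ + (d + 1) : ℕ) : ℝ) + 2 * (ℓ + (d + 1) : ℕ) * 1 := by gcongr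
      _ ≤ 8 * ℓ * (1 + (d + 1)) := by push_cast; nlinarith [(Nat.cast_nonneg d : (0 : ℝ) ≤ d)]
      _ ≤ _ := by gcongr

/-- The quantitative form of Pisier's inequality obtained from the linear proxy:
for every odd `ℓ > 0`, the Rademacher projection is bounded by
`8ℓ(1 + √m/2^ℓ)` in any norm on `ℝ^m`. -/
theorem pisier_quantitative (ℓ : ℕ) (hℓ : 0 < ℓ) (hodd : Odd ℓ)
    (n m : ℕ) (hn : 1 ≤ n) (hm : 1 ≤ m)
    (N : (Fin m → ℝ) → ℝ)
    (hN_add : ∀ x y, N (x + y) ≤ N x + N y)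
    (hN_smul : ∀ (c : ℝ) (x), N (c • x) = |c| * N x)
    (hN_zero : ∀ x, N x = 0 → x = 0)
    (f : (Fin n → ℝ) → (Fin m → ℝ)) :
    Real.sqrt (cubeAvg n fun x => (N (rad n f x)) ^ 2) ≤
      8 * ℓ * (1 + Real.sqrt m / 2 ^ ℓ) *
        Real.sqrt (cubeAvg n fun x => (N (f x)) ^ 2) := by
  let normN : Norm (Fin m → ℝ) := ⟨N⟩
  have hN₀ : N 0 = 0 := by simpa using hN_smul 0 0
  have hcore : NormedSpace.Core ℝ (Fin m → ℝ) :=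
    { norm_nonneg := fun x => by
        have h₁ := hN_add x ((-1 : ℝ) • x)
        have h₂ := hN_smul (-1) x
        rw [neg_one_smul, add_neg_cancel, hN₀] at h₁
        rw [neg_one_smul, abs_neg, abs_one, one_mul] at h₂
        change 0 ≤ N x
        linarith
      norm_smul := hN_smul
      norm_triangle := hN_add
      norm_eq_zero_iff := fun x => ⟨hN_zero x, fun h => h ▸ hN₀⟩ }
  obtain ⟨M, hM, hle⟩ := exists_degree_le hℓ (√m) (sqrt_nonneg _)
  rw [sq_sqrt (Nat.cast_nonneg m)] at hle
  have hfin : Module.Finite ℝ (Fin m → ℝ) := inferInstance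
  have hpos : 0 < Module.finrank ℝ (Fin m → ℝ) := by rwa [Module.finrank_fin_fun]
  let normedGroup : NormedAddCommGroup (Fin m → ℝ) := NormedAddCommGroup.ofCore hcore
  let normedSpace : @NormedSpace ℝ (Fin m → ℝ) _ normedGroup.toSeminormedAddCommGroup :=
    @NormedSpace.mk ℝ (Fin m → ℝ) _ normedGroup.toSeminormedAddCommGroup inferInstance
      fun c x => (hN_smul c x).le
  have hrad := @sum_sq_norm_rad_le (Fin m → ℝ) normedGroup normedSpace n hfin hpos M hM f
  rw [Module.finrank_fin_fun] at hrad
  change ∑ x ∈ cube n, N (rad n f x) ^ 2 ≤ _ * ∑ x ∈ cube n, N (f x) ^ 2 at hrad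
  refine le_trans ?_ (mul_le_mul_of_nonneg_right hle (sqrt_nonneg _))
  refine sqrt_le_iff.mpr ⟨by positivity, ?_⟩
  have hnonneg : 0 ≤ cubeAvg n fun x => N (f x) ^ 2 :=
    div_nonneg (sum_nonneg fun _ _ => sq_nonneg _) (by positivity)
  rw [mul_pow, sq_sqrt hnonneg, cubeAvg, cubeAvg, ← mul_div_assoc]
  gcongr
end
end
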